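/- arXiv:2505.03933 — 3 statements merged into one kernel-verified Lean document; each statement's English description precedes it below -/
import Mathlib

section
/- Let X be a fan with top v and let x₀ ∈ NS(X). Then there is an arc B in X such that x₀ ∈ B ⊆ NS(X). -/
open Set Filter Topology

/-- A set `A` is an arc if it is homeomorphic to the closed unit interval `[0,1]`. -/
def IsArc {X : Type} [TopologicalSpace X] (A : Set X) : Prop :=
  Nonempty (↥(Set.Icc (0:ℝ) 1) ≃ₜ ↥A)

/-- `x` is an end-point of the arc `A`: some homeomorphism `[0,1] ≃ₜ A` sends `0` to `x`. -/
def IsArcEndpoint {X : Type} [TopologicalSpace X] (A : Set X) (x : X) : Prop :=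
  ∃ e : ↥(Set.Icc (0:ℝ) 1) ≃ₜ ↥A, ((e ⟨0, le_refl 0, zero_le_one⟩ : A) : X) = x

/-- A subcontinuum: a nonempty compact connected subset. -/
def IsSubcontinuum {X : Type} [TopologicalSpace X] (A : Set X) : Prop :=
  IsCompact A ∧ IsConnected A

/-- Every subcontinuum `C` is unicoherent: whenever `C = A ∪ B` with `A`, `B`
subcontinua, the intersection `A ∩ B` is connected. -/
def HereditarilyUnicoherent (X : Type) [TopologicalSpace X] : Prop :=
  ∀ C A B : Set X, IsSubcontinuum C → IsSubcontinuum A → IsSubcontinuum B →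
    A ∪ B = C → IsConnected (A ∩ B)

/-- A dendroid: an arcwise connected, hereditarily unicoherent (metrizable) continuum. -/
def IsDendroid (X : Type) [TopologicalSpace X] : Prop :=
  Nonempty X ∧ CompactSpace X ∧ ConnectedSpace X ∧ TopologicalSpace.MetrizableSpace X ∧
  (∀ x y : X, x ≠ y → ∃ A : Set X, IsArcEndpoint A x ∧ IsArcEndpoint A y) ∧
  HereditarilyUnicoherent X

/-- The set of end-points of a dendroid: points which are end-points of every arc
containing them. -/
def DendroidEndpoints (X : Type) [TopologicalSpace X] : Set X :=
  {x | ∀ A : Set X, IsArc A → x ∈ A → IsArcEndpoint A x}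

/-- The model simple triode `([-1,1] × {0}) ∪ ({0} × [0,1]) ⊆ ℝ²`. -/
def TSet : Set (ℝ × ℝ) := (Set.Icc (-1:ℝ) 1 ×ˢ ({0} : Set ℝ)) ∪ (({0} : Set ℝ) ×ˢ Set.Icc (0:ℝ) 1)

lemma zero_mem_TSet : ((0:ℝ), (0:ℝ)) ∈ TSet :=
  Or.inl ⟨⟨by norm_num, by norm_num⟩, rfl⟩

/-- `T` is a simple triode with top `x`: some homeomorphism from the model triode onto `T`
sends `(0,0)` to `x`. -/
def IsSimpleTriodeWithTop {X : Type} [TopologicalSpace X] (T : Set X) (x : X) : Prop :=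
  ∃ e : ↥TSet ≃ₜ ↥T, ((e ⟨((0:ℝ), (0:ℝ)), zero_mem_TSet⟩ : T) : X) = x

/-- `x` is a ramification point: the top of some simple triode contained in the space. -/
def IsRamificationPoint {X : Type} [TopologicalSpace X] (x : X) : Prop :=
  ∃ T : Set X, IsSimpleTriodeWithTop T x

/-- A fan: a dendroid with at most one ramification point. -/
def IsFan (X : Type) [TopologicalSpace X] : Prop :=
  IsDendroid X ∧ ∀ x y : X, IsRamificationPoint x → IsRamificationPoint y → x = y

/-- `v` is the top of the fan: its ramification point if one exists, otherwise an end-point. -/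
def IsFanTop {X : Type} [TopologicalSpace X] (v : X) : Prop :=
  IsRamificationPoint v ∨
    ((∀ x : X, ¬ IsRamificationPoint x) ∧ v ∈ DendroidEndpoints X)

/-- A Lelek-like fan: a fan whose set of end-points is dense. -/
def IsLelekLikeFan (X : Type) [TopologicalSpace X] : Prop :=
  IsFan X ∧ Dense (DendroidEndpoints X)
/-- `A` is the (unique) arc in the fan joining `x` and `y`, where `[x,x] = {x}`. -/
def ArcConn {X : Type} [TopologicalSpace X] (A : Set X) (x y : X) : Prop :=
  (x = y ∧ A = {x}) ∨ (x ≠ y ∧ IsArcEndpoint A x ∧ IsArcEndpoint A y)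

/-- `x` is a non-smooth point of a fan with top `v`: there is a sequence `(xₙ)` of pairwise
distinct points converging to `x` such that the arcs `[v,xₙ]` do not converge to `[v,x]`
in the Hausdorff metric. -/
def NSPoint {X : Type} [MetricSpace X] (v x : X) : Prop :=
  ∃ xs : ℕ → X,
    (∀ m n : ℕ, m ≠ n → xs m ≠ xs n) ∧
    Filter.Tendsto xs Filter.atTop (nhds x) ∧
    ∃ (As : ℕ → Set X) (A₀ : Set X),
      (∀ n, ArcConn (As n) v (xs n)) ∧ ArcConn A₀ v x ∧
      ¬ Filter.Tendsto (fun n => EMetric.hausdorffEdist (As n) A₀) Filter.atTop (nhds 0)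

/-- The set of non-smooth points of a fan with top `v`. -/
def NS (X : Type) [MetricSpace X] (v : X) : Set X := {x | NSPoint v x}

/-- A fan with top `v` is smooth if whenever `xₙ → x`, the arcs `[v,xₙ]` converge to
`[v,x]` in the Hausdorff metric. -/
def SmoothFan (X : Type) [MetricSpace X] (v : X) : Prop :=
  ∀ (x : X) (xs : ℕ → X), Filter.Tendsto xs Filter.atTop (nhds x) →
    ∀ (As : ℕ → Set X) (A₀ : Set X),
      (∀ n, ArcConn (As n) v (xs n)) → ArcConn A₀ v x →
      Filter.Tendsto (fun n => EMetric.hausdorffEdist (As n) A₀) Filter.atTop (nhds 0)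

/-- A Lelek fan: a smooth fan with top `v` and a dense set of end-points. -/
def IsLelekFan (X : Type) [MetricSpace X] (v : X) : Prop :=
  IsFan X ∧ IsFanTop v ∧ SmoothFan X v ∧ Dense (DendroidEndpoints X)

/-- An injective path in a Hausdorff space parametrizes an arc between its end values. -/
theorem arcConn_range {X : Type} [TopologicalSpace X] [T2Space X] {γ : unitInterval → X}
    (hc : Continuous γ) (hi : Function.Injective γ) :
    ArcConn (range γ) (γ 0) (γ 1) := by
  have hemb := (hc.isClosedEmbedding hi).isEmbedding
  refine Or.inr ⟨fun h => zero_ne_one (hi h), ⟨hemb.toHomeomorph, rfl⟩,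
    ⟨unitInterval.symmHomeomorph.trans hemb.toHomeomorph, ?_⟩⟩
  exact congrArg γ unitInterval.symm_zero

/-- A self-homeomorphism of the unit interval moves `0` to `0` or `1`. -/
theorem unitInterval_homeomorph_zero (f : unitInterval ≃ₜ unitInterval) :
    f 0 = 0 ∨ f 0 = 1 := by
  rcases f.continuous.strictMono_of_inj f.injective with h | h
  · left
    obtain ⟨t, ht⟩ := f.surjective 0
    exact le_antisymm ((h.monotone unitInterval.nonneg').trans_eq ht) unitInterval.nonneg'
  · right
    obtain ⟨t, ht⟩ := f.surjective 1
    exact le_antisymm unitInterval.le_one' (ht.symm.trans_le (h.antitone unitInterval.nonneg'))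

/-- Every nondegenerate arc has an injective parametrization between its end-points. -/
theorem ArcConn.exists_param {X : Type} [TopologicalSpace X] {A : Set X} {x y : X}
    (h : ArcConn A x y) (hxy : x ≠ y) :
    ∃ γ : unitInterval → X, Continuous γ ∧ Function.Injective γ ∧ γ 0 = x ∧ γ 1 = y ∧
      range γ = A := by
  rcases h with h | ⟨-, ⟨e, he⟩, ⟨f, hf⟩⟩
  · exact absurd h.1 hxy
  refine ⟨fun t => e t, continuous_subtype_val.comp e.continuous,
    Subtype.val_injective.comp e.injective, he, ?_, ?_⟩
  · have key : e ((f.trans e.symm) 0) = f 0 := e.apply_symm_apply _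
    rcases unitInterval_homeomorph_zero (f.trans e.symm) with h0 | h0
    · rw [h0] at key
      exact absurd (he.symm.trans ((congrArg Subtype.val key).trans hf)) hxy
    · rw [h0] at key
      exact (congrArg Subtype.val key).trans hf
  · exact (e.surjective.range_comp Subtype.val).trans Subtype.range_coe

theorem ArcConn.isSubcontinuum {X : Type} [TopologicalSpace X] {A : Set X} {x y : X}
    (h : ArcConn A x y) : IsSubcontinuum A := by
  by_cases hxy : x = y
  · rcases h with h | h
    · rw [h.2]
      exact ⟨isCompact_singleton, isConnected_singleton⟩
    · exact absurd hxy h.1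
  · obtain ⟨γ, hc, -, -, -, rfl⟩ := h.exists_param hxy
    exact ⟨isCompact_range hc, isConnected_range hc⟩

theorem ArcConn.left_mem {X : Type} [TopologicalSpace X] {A : Set X} {x y : X}
    (h : ArcConn A x y) : x ∈ A := by
  rcases h with h | ⟨-, ⟨e, he⟩, -⟩
  · simp [h.2]
  · exact he ▸ Subtype.coe_prop _

theorem ArcConn.right_mem {X : Type} [TopologicalSpace X] {A : Set X} {x y : X}
    (h : ArcConn A x y) : y ∈ A := by
  rcases h with h | ⟨-, -, ⟨e, he⟩⟩
  · simp [h.2, h.1]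
  · exact he ▸ Subtype.coe_prop _

/-- In a dendroid, any two points are joined by a (possibly degenerate) arc. -/
theorem IsDendroid.exists_arcConn {X : Type} [TopologicalSpace X] (hX : IsDendroid X)
    (x y : X) : ∃ A : Set X, ArcConn A x y := by
  by_cases hxy : x = y
  · exact ⟨{x}, Or.inl ⟨hxy, rfl⟩⟩
  · obtain ⟨A, hA⟩ := hX.2.2.2.2.1 x y hxy
    exact ⟨A, Or.inr ⟨hxy, hA⟩⟩

theorem IsSubcontinuum.union {X : Type} [TopologicalSpace X] {A B : Set X}
    (hA : IsSubcontinuum A) (hB : IsSubcontinuum B) (h : (A ∩ B).Nonempty) :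
    IsSubcontinuum (A ∪ B) :=
  ⟨hA.1.union hB.1, IsConnected.union h hA.2 hB.2⟩

/-- In a hereditarily unicoherent space, a subcontinuum containing two points contains every
arc between them. -/
theorem ArcConn.subset_of_isSubcontinuum {X : Type} [TopologicalSpace X] [T2Space X]
    (hX : HereditarilyUnicoherent X) {A K : Set X} {x y : X} (h : ArcConn A x y)
    (hK : IsSubcontinuum K) (hx : x ∈ K) (hy : y ∈ K) : A ⊆ K := by
  by_cases hxy : x = y
  · rcases h with h | h
    · simpa [h.2] using hx
    · exact absurd hxy h.1
  have hconn : IsConnected (A ∩ K) :=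
    hX _ A K (h.isSubcontinuum.union hK ⟨x, h.left_mem, hx⟩) h.isSubcontinuum hK rfl
  obtain ⟨γ, hc, hi, rfl, rfl, rfl⟩ := h.exists_param hxy
  have hpre : IsPreconnected (γ ⁻¹' K) := by
    rw [← (hc.isClosedEmbedding hi).isEmbedding.isInducing.isPreconnected_image,
      image_preimage_eq_range_inter]
    exact hconn.isPreconnected
  rintro _ ⟨t, rfl⟩
  exact hpre.ordConnected.out hx hy ⟨unitInterval.nonneg', unitInterval.le_one'⟩

/-- Arcs in a hereditarily unicoherent space are determined by their end-points. -/
theorem ArcConn.unique {X : Type} [TopologicalSpace X] [T2Space X]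
    (hX : HereditarilyUnicoherent X) {A B : Set X} {x y : X} (hA : ArcConn A x y) (hB : ArcConn B x y) : A = B :=
  (hA.subset_of_isSubcontinuum hX hB.isSubcontinuum hB.left_mem hB.right_mem).antisymm
    (hB.subset_of_isSubcontinuum hX hA.isSubcontinuum hA.left_mem hA.right_mem)

/-- The initial part of an injectively parametrized arc, up to a positive parameter. -/
theorem arcConn_range_comp_mul {X : Type} [TopologicalSpace X] [T2Space X]
    {γ : unitInterval → X} (hc : Continuous γ) (hi : Function.Injective γ)
    {t : unitInterval} (ht : t ≠ 0) :
    ArcConn (range fun s => γ (s * t)) (γ 0) (γ t) := by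
  have h := arcConn_range (γ := fun s => γ (s * t)) (by fun_prop) fun a b hab => by
    have h' := congrArg Subtype.val (hi hab)
    exact Subtype.ext (mul_right_cancel₀ (fun h0 => ht (Subtype.ext h0)) h')
  simpa using h

/-- The part `C` of an arc from `v` to `x` lying beyond `y`: each `z ∈ C` is joined to `v` by an
arc through `y`. -/
theorem ArcConn.exists_beyond {X : Type} [TopologicalSpace X] [T2Space X] {A : Set X}
    {v x y : X} (h : ArcConn A v x) (hy : y ∈ A) :
    ∃ C : Set X, IsSubcontinuum C ∧ y ∈ C ∧ x ∈ C ∧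
      ∀ z ∈ C, ∃ D : Set X, ArcConn D v z ∧ y ∈ D := by
  by_cases hvx : v = x
  · rcases h with h' | h'
    · obtain rfl : y = v := by simpa [h'.2] using hy
      subst hvx
      refine ⟨{y}, ⟨isCompact_singleton, isConnected_singleton⟩, rfl, rfl, ?_⟩
      rintro z rfl
      exact ⟨{z}, Or.inl ⟨rfl, rfl⟩, rfl⟩
    · exact absurd hvx h'.1
  obtain ⟨γ, hc, hi, rfl, rfl, rfl⟩ := h.exists_param hvx
  obtain ⟨s, rfl⟩ := hy
  refine ⟨γ '' Icc s 1, ⟨isCompact_Icc.image hc,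
    (isConnected_Icc unitInterval.le_one').image γ hc.continuousOn⟩,
    ⟨s, ⟨le_rfl, unitInterval.le_one'⟩, rfl⟩, ⟨1, ⟨unitInterval.le_one', le_rfl⟩, rfl⟩, ?_⟩
  rintro _ ⟨t, ⟨hst, -⟩, rfl⟩
  by_cases ht : t = 0
  · subst ht
    obtain rfl : s = 0 := le_antisymm hst unitInterval.nonneg'
    exact ⟨{γ 0}, Or.inl ⟨rfl, rfl⟩, rfl⟩
  · refine ⟨_, arcConn_range_comp_mul hc hi ht,
      ⟨⟨s / t, unitInterval.div_mem s.2.1 t.2.1 hst⟩, congrArg γ (Subtype.ext ?_)⟩⟩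
    exact div_mul_cancel₀ (s : ℝ) fun h0 => ht (Subtype.ext h0)

/-- The upper limit of a sequence of connected sets containing a convergent sequence of points
is connected. -/
theorem isSubcontinuum_limsup {X : Type} [TopologicalSpace X] [CompactSpace X] [T2Space X]
    {C : ℕ → Set X} (hC : ∀ n, IsPreconnected (C n)) {p : ℕ → X} (hp : ∀ n, p n ∈ C n)
    {a : X} {l : Filter ℕ} [l.NeBot] (hpa : Tendsto p l (𝓝 a)) :
    IsSubcontinuum {x | ∀ W ∈ 𝓝 x, ∃ᶠ n in l, (C n ∩ W).Nonempty} := by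
  set K : Set X := {x | ∀ W ∈ 𝓝 x, ∃ᶠ n in l, (C n ∩ W).Nonempty} with hKdef
  have haK : a ∈ K := fun W hW =>
    ((hpa.eventually_mem hW).mono fun n hn => ⟨p n, hp n, hn⟩).frequently
  have hclosed : IsClosed K := by
    refine isClosed_of_closure_subset fun x hx W hW => ?_
    obtain ⟨O, hOW, hO, hxO⟩ := mem_nhds_iff.1 hW
    obtain ⟨y, hyO, hyK⟩ := mem_closure_iff.1 hx O hO hxO
    exact (hyK O (hO.mem_nhds hyO)).mono fun n hn => hn.mono (inter_subset_inter_right _ hOW)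
  have hcover : ∀ O : Set X, IsOpen O → K ⊆ O → ∀ᶠ n in l, C n ⊆ O := by
    intro O hO hKO
    have hloc : ∀ x ∈ Oᶜ, ∃ W ∈ 𝓝 x, ∀ᶠ n in l, ¬ (C n ∩ W).Nonempty := by
      intro x hx
      have hxK : x ∉ K := fun h => hx (hKO h)
      simpa [hKdef, Filter.not_frequently] using hxK
    choose! W hW hWC using hloc
    obtain ⟨t, htO, ht⟩ := hO.isClosed_compl.isCompact.elim_nhds_subcover W hW
    have hall : ∀ᶠ n in l, ∀ x ∈ t, ¬ (C n ∩ W x).Nonempty :=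
      (Finset.eventually_all t).2 fun x hx => hWC x (htO x hx)
    filter_upwards [hall] with n hn y hy
    by_contra hyO
    obtain ⟨x, hx, hyW⟩ := mem_iUnion₂.1 (ht hyO)
    exact hn x hx ⟨y, hy, hyW⟩
  refine ⟨hclosed.isCompact, ⟨a, haK⟩, ?_⟩
  have main : ∀ K₁ K₂ : Set X, IsClosed K₁ → IsClosed K₂ → K ⊆ K₁ ∪ K₂ →
      K ∩ (K₁ ∩ K₂) = ∅ → a ∈ K₁ → (K ∩ K₂).Nonempty → False := by
    rintro K₁ K₂ h₁ h₂ hsub hdisj ha ⟨b, hbK, hb⟩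
    obtain ⟨O₁, O₂, hO₁, hO₂, hKO₁, hKO₂, hO⟩ :=
      SeparatedNhds.of_isCompact_isCompact (hclosed.inter h₁).isCompact
        (hclosed.inter h₂).isCompact (by
          rw [Set.disjoint_left]
          rintro x ⟨hx, hx₁⟩ ⟨-, hx₂⟩
          exact (hdisj ▸ (⟨hx, hx₁, hx₂⟩ : x ∈ K ∩ (K₁ ∩ K₂)) : x ∈ (∅ : Set X)))
    have hev := hcover (O₁ ∪ O₂) (hO₁.union hO₂) fun x hx =>
      (hsub hx).imp (fun h => hKO₁ ⟨hx, h⟩) (fun h => hKO₂ ⟨hx, h⟩)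
    obtain ⟨n, hn₂, hn, hn₁⟩ := ((hbK O₂ (hO₂.mem_nhds (hKO₂ ⟨hbK, hb⟩))).and_eventually
      (hev.and (hpa.eventually_mem (hO₁.mem_nhds (hKO₁ ⟨haK, ha⟩))))).exists
    obtain ⟨z, -, hz⟩ := hC n O₁ O₂ hO₁ hO₂ hn ⟨p n, hp n, hn₁⟩ hn₂
    exact Set.disjoint_left.1 hO hz.1 hz.2
  rw [isPreconnected_closed_iff]
  intro K₁ K₂ h₁ h₂ hsub hne₁ hne₂
  by_contra hne
  rw [Set.not_nonempty_iff_eq_empty] at hne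
  rcases hsub haK with ha | ha
  · exact main K₁ K₂ h₁ h₂ hsub hne ha hne₂
  · exact main K₂ K₁ h₂ h₁ (union_comm K₁ K₂ ▸ hsub) (inter_comm K₁ K₂ ▸ hne) ha hne₁

/-- In a dendroid, continua whose marked points converge to the end-points of an arc accumulate
at every point of the arc. -/
theorem ArcConn.eventually_inter_nonempty {X : Type} [TopologicalSpace X] [CompactSpace X]
    [T2Space X] (hX : HereditarilyUnicoherent X) {A : Set X} {a b z : X} (hA : ArcConn A a b)
    {C : ℕ → Set X} (hC : ∀ n, IsSubcontinuum (C n)) {p q : ℕ → X} (hp : ∀ n, p n ∈ C n)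
    (hq : ∀ n, q n ∈ C n) (hpa : Tendsto p atTop (𝓝 a)) (hqb : Tendsto q atTop (𝓝 b))
    (hz : z ∈ A) {W : Set X} (hW : W ∈ 𝓝 z) : ∀ᶠ n in atTop, (C n ∩ W).Nonempty := by
  by_contra hcon
  let l : Filter ℕ := atTop ⊓ 𝓟 {n | ¬ (C n ∩ W).Nonempty}
  have : l.NeBot := frequently_mem_iff_neBot.1 (not_eventually.1 hcon)
  have hpa' : Tendsto p l (𝓝 a) := hpa.mono_left inf_le_left
  have hqb' : Tendsto q l (𝓝 b) := hqb.mono_left inf_le_left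
  have hmem := hA.subset_of_isSubcontinuum hX
    (isSubcontinuum_limsup (fun n => (hC n).2.isPreconnected) hp hpa')
    (fun V hV => ((hpa'.eventually_mem hV).mono fun n hn => ⟨p n, hp n, hn⟩).frequently)
    (fun V hV => ((hqb'.eventually_mem hV).mono fun n hn => ⟨q n, hq n, hn⟩).frequently) hz
  have hev : ∀ᶠ n in l, ¬ (C n ∩ W).Nonempty :=
    (inf_le_right : l ≤ _) (mem_principal_self _)
  exact hmem W hW hev

/-- A criterion for non-smoothness: points `z n → z` joined to `v` by arcs passing through points
`y n` that converge off the arc from `v` to `z`. -/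
theorem nsPoint_of_tendsto {X : Type} [MetricSpace X] (hX : HereditarilyUnicoherent X)
    {v y z : X} {A : Set X} (hA : ArcConn A v z) (hyA : y ∉ A) {ys zs : ℕ → X}
    {D : ℕ → Set X} (hD : ∀ n, ArcConn (D n) v (zs n)) (hyD : ∀ n, ys n ∈ D n)
    (hys : Tendsto ys atTop (𝓝 y)) (hzs : Tendsto zs atTop (𝓝 z)) : NSPoint v z := by
  have hAcl : IsClosed A := hA.isSubcontinuum.1.isClosed
  have hne : ∀ᶠ n in atTop, zs n ≠ z := by
    filter_upwards [hys.eventually_mem (hAcl.isOpen_compl.mem_nhds hyA)] with n hn hz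
    have hDn := hD n
    rw [hz] at hDn
    exact hn (hDn.unique hX hA ▸ hyD n)
  have hdist : Tendsto (fun n => (dist (zs n) z)⁻¹) atTop atTop := by
    refine Tendsto.inv_tendsto_nhdsGT_zero (tendsto_nhdsWithin_iff.2 ⟨?_, ?_⟩)
    · exact tendsto_iff_dist_tendsto_zero.1 hzs
    · exact hne.mono fun n hn => dist_pos.2 hn
  obtain ⟨φ, hφ, hmono⟩ := strictMono_subseq_of_tendsto_atTop hdist
  refine ⟨zs ∘ φ, fun m n hmn h => hmn (hmono.injective ?_), hzs.comp hφ.tendsto_atTop,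
    D ∘ φ, A, fun n => hD _, hA, fun hlim => ?_⟩
  · exact congrArg (fun w => (dist w z)⁻¹) h
  · have hinf : Tendsto (fun n => Metric.infEDist (ys (φ n)) A) atTop
        (𝓝 (Metric.infEDist y A)) :=
      (Metric.continuous_infEDist.tendsto y).comp (hys.comp hφ.tendsto_atTop)
    have hle : Metric.infEDist y A ≤ 0 := le_of_tendsto_of_tendsto' hinf hlim
      fun n => Metric.infEDist_le_hausdorffEDist_of_mem (hyD _)
    exact hyA ((Metric.mem_iff_infEDist_zero_of_closed hAcl).2 (le_antisymm hle bot_le))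

/-- Near a non-smooth point `x` of a dendroid, arcs from `v` pass through points converging off
the arc from `v` to `x`. -/
theorem NSPoint.exists_tendsto {X : Type} [MetricSpace X] [CompactSpace X]
    (hX : HereditarilyUnicoherent X) {v x : X} (h : NSPoint v x) :
    ∃ (xs ys : ℕ → X) (As : ℕ → Set X) (A : Set X) (y : X), Tendsto xs atTop (𝓝 x) ∧
      (∀ n, ArcConn (As n) v (xs n)) ∧ ArcConn A v x ∧ (∀ n, ys n ∈ As n) ∧ y ∉ A ∧
      Tendsto ys atTop (𝓝 y) := by
  obtain ⟨xs, -, hxs, As, A, hAs, hA, hlim⟩ := h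
  obtain ⟨ε, hε, hfreq⟩ : ∃ ε > 0, ∃ᶠ n in atTop, ε < Metric.hausdorffEDist (As n) A := by
    by_contra! hcon
    exact hlim (ENNReal.tendsto_nhds_zero.2 fun ε hε =>
      hcon ε hε)
  have hcover : ∀ᶠ n in atTop, ∀ a ∈ A, Metric.infEDist a (As n) ≤ ε := by
    have hε2 : 0 < ε / 2 := ENNReal.half_pos hε.ne'
    obtain ⟨t, htA, ht⟩ := hA.isSubcontinuum.1.elim_nhds_subcover
      (fun a => Metric.eball a (ε / 2)) fun a _ => Metric.eball_mem_nhds a hε2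
    have hall : ∀ᶠ n in atTop, ∀ a ∈ t, (As n ∩ Metric.eball a (ε / 2)).Nonempty :=
      (Finset.eventually_all t).2 fun a ha =>
        hA.eventually_inter_nonempty hX (fun n => (hAs n).isSubcontinuum)
          (fun n => (hAs n).left_mem) (fun n => (hAs n).right_mem) tendsto_const_nhds hxs
          (htA a ha) (Metric.eball_mem_nhds a hε2)
    filter_upwards [hall] with n hn a ha
    obtain ⟨b, hb, hab⟩ := mem_iUnion₂.1 (ht ha)
    obtain ⟨w, hwA, hwb⟩ := hn b hb
    calc Metric.infEDist a (As n) ≤ edist a w := Metric.infEDist_le_edist_of_mem hwA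
      _ ≤ edist a b + edist w b := edist_triangle_right a w b
      _ ≤ ε / 2 + ε / 2 := add_le_add (Metric.mem_eball.1 hab).le (Metric.mem_eball.1 hwb).le
      _ = ε := ENNReal.add_halves ε
  have hfreq' : ∃ᶠ n in atTop, ∃ y ∈ As n, ε < Metric.infEDist y A := by
    refine (hfreq.and_eventually hcover).mono fun n ⟨hn, hn'⟩ => ?_
    by_contra! hcon
    exact hn.not_ge (Metric.hausdorffEDist_le_of_infEDist hcon hn')
  obtain ⟨φ, hφ, hy⟩ := extraction_of_frequently_atTop hfreq'
  choose ys hysA hys using hy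
  obtain ⟨y, ψ, hψ, hyψ⟩ := CompactSpace.tendsto_subseq ys
  refine ⟨xs ∘ φ ∘ ψ, ys ∘ ψ, As ∘ φ ∘ ψ, A, y,
    hxs.comp (hφ.comp hψ).tendsto_atTop, fun n => hAs _, hA, fun n => hysA _, fun hyA => ?_, hyψ⟩
  have hle : ε ≤ Metric.infEDist y A :=
    ge_of_tendsto' ((Metric.continuous_infEDist.tendsto y).comp hyψ) fun n => (hys _).le
  rw [Metric.infEDist_zero_of_mem hyA] at hle
  exact hle.not_gt hε

/-- If `x₀` is a non-smooth point of a fan `X` with top `v`, then there is an arc `B` in `X`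
with `x₀ ∈ B ⊆ NS(X)`. -/
theorem statement5 {X : Type} [MetricSpace X] (v : X) (hX : IsFan X) (hv : IsFanTop v)
    (x₀ : X) (hx₀ : x₀ ∈ NS X v) :
    ∃ B : Set X, IsArc B ∧ x₀ ∈ B ∧ B ⊆ NS X v := by
  have hdend := hX.1
  have : CompactSpace X := hdend.2.1
  have hu : HereditarilyUnicoherent X := hdend.2.2.2.2.2
  obtain ⟨xs, ys, As, A, y, hxs, hAs, hA, hysA, hyA, hys⟩ := NSPoint.exists_tendsto hu hx₀
  have hxy : x₀ ≠ y := fun h => hyA (h ▸ hA.right_mem)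
  obtain ⟨E, hE⟩ := hdend.exists_arcConn x₀ y
  obtain ⟨γ, hc, hi, hγ0, hγ1, hγE⟩ := hE.exists_param hxy
  let r : unitInterval := ⟨1 / 2, by norm_num, by norm_num⟩
  have hr : r ≠ 0 := fun h => by simpa [r] using congrArg Subtype.val h
  have hB := arcConn_range_comp_mul hc hi hr
  rw [hγ0] at hB
  have hyB : y ∉ range fun s => γ (s * r) := by
    rintro ⟨s, hs⟩
    have h1 : (s : ℝ) * (1 / 2) = 1 := congrArg Subtype.val (hi (hs.trans hγ1.symm))
    linarith [s.2.2]
  refine ⟨range fun s => γ (s * r), ?_, hB.left_mem, ?_⟩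
  · rcases hB with h | ⟨-, ⟨e, -⟩, -⟩
    · exact absurd (hi (hγ0.trans h.1)) hr.symm
    · exact ⟨e⟩
  rintro z hz
  obtain ⟨D, hD⟩ := hdend.exists_arcConn v z
  have hyD : y ∉ D := fun h =>
    (hD.subset_of_isSubcontinuum hu
      (hA.isSubcontinuum.union hB.isSubcontinuum ⟨x₀, hA.right_mem, hB.left_mem⟩)
      (Or.inl hA.left_mem) (Or.inr hz) h).elim hyA hyB
  have hzE : z ∈ E := by
    obtain ⟨s, rfl⟩ := hz
    exact hγE ▸ mem_range_self _
  choose C hC hyC hxC hCD using fun n => (hAs n).exists_beyond (hysA n)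
  have hmeet : ∀ k : ℕ, ∀ᶠ n in atTop, (C n ∩ Metric.ball z (1 / ((k : ℝ) + 1))).Nonempty :=
    fun k => hE.eventually_inter_nonempty hu hC hxC hyC hxs hys hzE
      (Metric.ball_mem_nhds z Nat.one_div_pos_of_nat)
  obtain ⟨φ, hφ, hmeet'⟩ := extraction_forall_of_eventually hmeet
  choose zs hzC hzball using hmeet'
  choose Ds hDs hyDs using fun k => hCD (φ k) (zs k) (hzC k)
  refine nsPoint_of_tendsto hu hD hyD hDs hyDs (hys.comp hφ.tendsto_atTop) ?_
  rw [tendsto_iff_dist_tendsto_zero]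
  exact squeeze_zero (fun _ => dist_nonneg) (fun k => (Metric.mem_ball.1 (hzball k)).le)
    tendsto_one_div_add_atTop_nhds_zero_nat
end

section
/- For every (r,ρ) ∈ NC, the dynamical systems (𝕏_H^+, σ_H^+) and (𝕏_H, σ_H) are topologically mixing. -/
/-- A dynamical system is topologically mixing if for all nonempty open sets `U`, `V`
there is `n₀` such that `f^[n] '' U` meets `V` for every `n ≥ n₀`. -/
def TopologicallyMixing {X : Type} [TopologicalSpace X] (f : X → X) : Prop :=
  ∀ U V : Set X, IsOpen U → IsOpen V → U.Nonempty → V.Nonempty →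
    ∃ n₀ : ℕ, ∀ n : ℕ, n₀ ≤ n → (f^[n] '' U ∩ V).Nonempty

/-- A dynamical system is (topologically) transitive if for all nonempty open sets `U`, `V`
there is `n ≥ 0` such that `f^[n] '' U` meets `V`. -/
def TopologicallyTransitive {X : Type} [TopologicalSpace X] (f : X → X) : Prop :=
  ∀ U V : Set X, IsOpen U → IsOpen V → U.Nonempty → V.Nonempty →
    ∃ n : ℕ, (f^[n] '' U ∩ V).Nonempty
/-- The Mahavier product of a closed relation `F` on `X`: all forward `F`-orbits. -/
def MahavierPlus {X : Type} (F : Set (X × X)) : Set (ℕ → X) :=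
  {x | ∀ i : ℕ, (x i, x (i+1)) ∈ F}

/-- The two-sided Mahavier product of a closed relation `F` on `X`. -/
def MahavierTwo {X : Type} (F : Set (X × X)) : Set (ℤ → X) :=
  {x | ∀ i : ℤ, (x i, x (i+1)) ∈ F}

/-- The shift map `σ_F⁺` on the Mahavier product. -/
def shiftPlus {X : Type} (F : Set (X × X)) (x : ↥(MahavierPlus F)) : ↥(MahavierPlus F) :=
  ⟨fun i => x.1 (i+1), fun i => x.2 (i+1)⟩

/-- The shift map `σ_F` on the two-sided Mahavier product. -/
def shiftTwo {X : Type} (F : Set (X × X)) (x : ↥(MahavierTwo F)) : ↥(MahavierTwo F) :=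
  ⟨fun i => x.1 (i+1), fun i => x.2 (i+1)⟩
/-- The locally compact space `[0,1] ∪ [2,3] ∪ [4,5] ∪ ⋯ ⊆ ℝ` (so `I_k = [2k-2, 2k-1]`). -/
def Ybase : Set ℝ := {x : ℝ | ∃ k : ℕ, x ∈ Set.Icc (2*(k:ℝ)) (2*(k:ℝ)+1)}

/-- The compact space `𝕏`: the one-point compactification of `[0,1] ∪ [2,3] ∪ [4,5] ∪ ⋯`. -/
abbrev XSpace : Type := OnePoint ↥Ybase
/-- The relation `H` on `𝕏` (for parameters `r < 1 < ρ`): `t ↦ rt` and `t ↦ ρt` on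
`I₁ = [0,1]` (the latter where `ρt ≤ 1`), `t ↦ t+2` on `⋃_{k≥1} I_k`, `t ↦ t-2` on
`⋃_{k≥2} I_k`, the identity on `⋃_{k≥1} I_k`, and `(∞,∞)`. -/
def Hrel (r ρ : ℝ) : Set (XSpace × XSpace) :=
  {p | ∃ y z : Ybase, (y:ℝ) ≤ 1 ∧ (z:ℝ) = r * (y:ℝ) ∧ p = ((y : XSpace), (z : XSpace))} ∪
  {p | ∃ y z : Ybase, (y:ℝ) ≤ 1 ∧ ρ * (y:ℝ) ≤ 1 ∧ (z:ℝ) = ρ * (y:ℝ) ∧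
        p = ((y : XSpace), (z : XSpace))} ∪
  {p | ∃ y z : Ybase, (z:ℝ) = (y:ℝ) + 2 ∧ p = ((y : XSpace), (z : XSpace))} ∪
  {p | ∃ y z : Ybase, 2 ≤ (y:ℝ) ∧ (z:ℝ) = (y:ℝ) - 2 ∧ p = ((y : XSpace), (z : XSpace))} ∪
  {p | ∃ y : Ybase, p = ((y : XSpace), (y : XSpace))} ∪
  {(OnePoint.infty, OnePoint.infty)}

/-- `(r,ρ) ∈ 𝒩𝒞`: `r` and `ρ` never connect. -/
def NeverConnect (r ρ : ℝ) : Prop :=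
  0 < r ∧ r < 1 ∧ 1 < ρ ∧ ∀ k l : ℤ, r ^ k = ρ ^ l ↔ k = 0 ∧ l = 0

section Paths

variable {X : Type} {F : Set (X × X)}

/-- There is an `F`-path with `n` steps from `a` to `b`. -/
def HasPath (F : Set (X × X)) (n : ℕ) (a b : X) : Prop :=
  ∃ z : ℕ → X, z 0 = a ∧ z n = b ∧ ∀ i < n, (z i, z (i + 1)) ∈ F

lemma HasPath.tail {n : ℕ} {a b c : X} (h : HasPath F n a b) (hbc : (b, c) ∈ F) :
    HasPath F (n + 1) a c := by
  obtain ⟨z, h0, hn, hz⟩ := h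
  refine ⟨fun i => if i ≤ n then z i else c, by simpa using h0, by simp, fun i hi => ?_⟩
  rcases Nat.lt_succ_iff_lt_or_eq.mp hi with hi | rfl
  · have h1 : i ≤ n := hi.le
    have h2 : i + 1 ≤ n := hi
    simpa [h1, h2] using hz i hi
  · simpa [hn] using hbc

lemma exists_hasPath_of_reflTransGen (hF : ∀ a, (a, a) ∈ F) {a b : X}
    (h : Relation.ReflTransGen (fun a b => (a, b) ∈ F) a b) :
    ∃ N : ℕ, ∀ n, N ≤ n → HasPath F n a b := by
  suffices ∃ N, HasPath F N a b by
    obtain ⟨N, hN⟩ := this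
    refine ⟨N, fun n hn => ?_⟩
    induction n, hn using Nat.le_induction with
    | base => exact hN
    | succ n _ ih => exact ih.tail (hF b)
  induction h with
  | refl => exact ⟨0, fun _ => a, rfl, rfl, by simp⟩
  | tail _ hbc ih => exact ⟨_, ih.choose_spec.tail hbc⟩

/-- Two finite `F`-chains joined by an `F`-path extend to a two-sided orbit of the
reflexive relation `F`. -/
lemma exists_orbit_of_chains (hF : ∀ a, (a, a) ∈ F) {M L : ℕ} {p w : ℕ → X}
    (hp : ∀ i < M, (p i, p (i + 1)) ∈ F) (hw : ∀ i < M, (w i, w (i + 1)) ∈ F)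
    (hpw : HasPath F L (p M) (w 0)) :
    ∃ z ∈ MahavierTwo F, (∀ i : ℕ, i ≤ M → z i = p i) ∧
      ∀ i : ℕ, i ≤ M → z ((M + L + i : ℕ) : ℤ) = w i := by
  obtain ⟨q, hq0, hqL, hq⟩ := hpw
  refine ⟨fun i => if i ≤ M then p i.toNat else if i ≤ M + L then q (i - M).toNat
    else w (min (i - M - L).toNat M), fun i => ?_, fun i hi => ?_, fun i hi => ?_⟩
  · rcases lt_or_ge i 0 with h0 | h0
    · have e1 : i.toNat = 0 := by omega
      have e2 : (i + 1).toNat = 0 := by omega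
      have h1 : i ≤ M := by omega
      have h2 : i + 1 ≤ M := by omega
      simpa [e1, e2, h1, h2] using hF _
    lift i to ℕ using h0
    rcases lt_or_ge i M with h | h
    · have h1 : (i : ℤ) ≤ M := by omega
      have h2 : (i : ℤ) + 1 ≤ M := by omega
      have e2 : ((i : ℤ) + 1).toNat = i + 1 := by omega
      simpa only [h1, h2, e2, if_true, Int.toNat_natCast] using hp i h
    obtain ⟨j, rfl⟩ := Nat.exists_eq_add_of_le h
    have key1 : (if ((M + j : ℕ) : ℤ) ≤ M then p ((M + j : ℕ) : ℤ).toNat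
        else if ((M + j : ℕ) : ℤ) ≤ M + L then q (((M + j : ℕ) : ℤ) - M).toNat
        else w (min (((M + j : ℕ) : ℤ) - M - L).toNat M)) =
        if j ≤ L then q j else w (min (j - L) M) := by
      rcases Nat.eq_zero_or_pos j with rfl | hj
      · simp [hq0]
      · have h1 : ¬ ((M + j : ℕ) : ℤ) ≤ M := by omega
        have e1 : (((M + j : ℕ) : ℤ) - M).toNat = j := by omega
        have e2 : (((M + j : ℕ) : ℤ) - M - L).toNat = j - L := by omega
        have h2 : (((M + j : ℕ) : ℤ) ≤ M + L) ↔ j ≤ L := by omega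
        simp only [h1, e1, e2, h2, if_false]
    have key2 : (if ((M + j : ℕ) : ℤ) + 1 ≤ M then p (((M + j : ℕ) : ℤ) + 1).toNat
        else if ((M + j : ℕ) : ℤ) + 1 ≤ M + L then q (((M + j : ℕ) : ℤ) + 1 - M).toNat
        else w (min (((M + j : ℕ) : ℤ) + 1 - M - L).toNat M)) =
        if j + 1 ≤ L then q (j + 1) else w (min (j + 1 - L) M) := by
      have h1 : ¬ ((M + j : ℕ) : ℤ) + 1 ≤ M := by omega
      have e1 : (((M + j : ℕ) : ℤ) + 1 - M).toNat = j + 1 := by omega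
      have e2 : (((M + j : ℕ) : ℤ) + 1 - M - L).toNat = j + 1 - L := by omega
      have h2 : (((M + j : ℕ) : ℤ) + 1 ≤ M + L) ↔ j + 1 ≤ L := by omega
      simp only [h1, e1, e2, h2, if_false]
    simp only [key1, key2]
    rcases lt_or_ge j L with hj | hj
    · have h1 : j ≤ L := hj.le
      have h2 : j + 1 ≤ L := hj
      simpa only [h1, h2, if_true] using hq j hj
    obtain ⟨k, rfl⟩ := Nat.exists_eq_add_of_le hj
    have key3 : (if L + k ≤ L then q (L + k) else w (min (L + k - L) M)) = w (min k M) := by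
      rcases Nat.eq_zero_or_pos k with rfl | hk
      · simp [hqL]
      · have h1 : ¬ L + k ≤ L := by omega
        have e1 : L + k - L = k := by omega
        simp only [h1, e1, if_false]
    have h2 : ¬ L + k + 1 ≤ L := by omega
    have e2 : L + k + 1 - L = k + 1 := by omega
    simp only [key3, h2, e2, if_false]
    rcases lt_or_ge k M with hk | hk
    · simpa only [min_eq_left hk.le, min_eq_left (Nat.succ_le_of_lt hk)] using hw k hk
    · simpa only [min_eq_right hk, min_eq_right (hk.trans k.le_succ)] using hF _
  · simp [hi]
  · rcases Nat.eq_zero_or_pos i with rfl | h0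
    · rcases Nat.eq_zero_or_pos L with rfl | hL
      · simp [← hq0, hqL]
      · have h1 : ¬ ((M + L + 0 : ℕ) : ℤ) ≤ M := by omega
        have h2 : ((M + L + 0 : ℕ) : ℤ) ≤ M + L := by omega
        have e1 : (((M + L + 0 : ℕ) : ℤ) - M).toNat = L := by omega
        simp only [h1, h2, e1, hqL, if_true, if_false]
    · have h1 : ¬ ((M + L + i : ℕ) : ℤ) ≤ M := by omega
      have h2 : ¬ ((M + L + i : ℕ) : ℤ) ≤ M + L := by omega
      have e1 : (((M + L + i : ℕ) : ℤ) - M - L).toNat = i := by omega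
      simp only [h1, h2, e1, min_eq_left hi, if_false]

end Paths

section Density

open Filter Topology

lemma exists_natCast_mul_add_natCast_mul_mem {α β w : ℝ} (hα : α < 0) (hβ : 0 < β)
    (h : Irrational (α / β)) {O : Set ℝ} (hO : IsOpen O) (hw : w ∈ O) :
    ∃ a b : ℕ, a * α + b * β ∈ O := by
  have : Fact (0 < β) := ⟨hβ⟩
  have hd : DenseRange (· • (α : AddCircle β) : ℤ → AddCircle β) :=
    AddCircle.denseRange_zsmul_coe_iff.2 h
  have hc : MapClusterPt (w : AddCircle β) atTop (· • (α : AddCircle β) : ℕ → AddCircle β) :=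
    ((mapClusterPt_atTop_nsmul_tfae (w : AddCircle β) (α : AddCircle β)).out 0 3).2 (hd _)
  have hO' : IsOpen (((↑) : ℝ → AddCircle β) '' (O ∩ Set.Ioi (w - 1))) :=
    QuotientAddGroup.isOpenMap_coe _ (hO.inter isOpen_Ioi)
  have hfreq := hc.frequently (hO'.mem_nhds ⟨w, ⟨hw, by simp⟩, rfl⟩)
  have hlim : ∀ᶠ n : ℕ in atTop, (n : ℝ) * α ≤ w - 1 :=
    (tendsto_natCast_atTop_atTop.atTop_mul_const_of_neg hα).eventually_le_atBot _
  obtain ⟨a, ⟨x, ⟨hxO, hxw⟩, hx⟩, ha⟩ := (hfreq.and_eventually hlim).exists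
  have hx' : ((a * α : ℝ) : AddCircle β) = x := by
    rw [hx, ← nsmul_eq_mul, AddCircle.coe_nsmul]
  obtain ⟨m, hm⟩ := AddSubgroup.mem_zmultiples_iff.1 (QuotientAddGroup.eq.1 hx')
  rw [zsmul_eq_mul] at hm
  have hm0 : 0 < (m : ℝ) := by
    refine pos_of_mul_pos_left (b := β) ?_ hβ.le
    linarith [Set.mem_Ioi.1 hxw]
  obtain ⟨b, rfl⟩ := Int.eq_ofNat_of_zero_le (a := m) (by exact_mod_cast hm0.le)
  refine ⟨a, b, ?_⟩
  rwa [show (a : ℝ) * α + b * β = x by push_cast at hm; linarith]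

lemma exists_pow_mul_pow_mul_mem {r ρ : ℝ} (hNC : NeverConnect r ρ) {s u : ℝ} (hs : 0 < s)
    (hu : 0 < u) {O : Set ℝ} (hO : IsOpen O) (huO : u ∈ O) :
    ∃ a b : ℕ, ρ ^ b * (r ^ a * s) ∈ O := by
  obtain ⟨hr0, hr1, hρ, hNC⟩ := hNC
  have hρ0 : 0 < ρ := by linarith
  have hlr := Real.log_neg hr0 hr1
  have hlρ := Real.log_pos hρ
  have hirr : Irrational (Real.log r / Real.log ρ) := by
    rintro ⟨q, hq⟩
    have hq' : (q.den : ℤ) * Real.log r = q.num * Real.log ρ := by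
      have hd : (q.den : ℝ) ≠ 0 := by exact_mod_cast q.den_ne_zero
      rw [Rat.cast_def] at hq
      field_simp at hq
      push_cast
      linarith
    have hpow : r ^ (q.den : ℤ) = ρ ^ q.num := by
      apply Real.log_injOn_pos (Set.mem_Ioi.2 (zpow_pos hr0 _)) (Set.mem_Ioi.2 (zpow_pos hρ0 _))
      rw [Real.log_zpow, Real.log_zpow, hq']
    exact q.den_ne_zero (by exact_mod_cast ((hNC _ _).1 hpow).1)
  obtain ⟨a, b, hab⟩ := exists_natCast_mul_add_natCast_mul_mem (w := Real.log (u / s)) hlr hlρ hirr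
    (O := (fun x => Real.exp x * s) ⁻¹' O) (hO.preimage (by fun_prop))
    (by simpa [Real.exp_log (div_pos hu hs), div_mul_cancel₀ _ hs.ne'] using huO)
  refine ⟨a, b, ?_⟩
  have : Real.exp (a * Real.log r + b * Real.log ρ) * s = ρ ^ b * (r ^ a * s) := by
    rw [Real.exp_add, Real.exp_nat_mul, Real.exp_nat_mul, Real.exp_log hr0, Real.exp_log hρ0]
    ring
  rwa [← this]

end Density

section Points

open Filter Topology

/-- The point `2 k + u` of `𝕏`, where `u` is first clamped to `[0, 1]`. -/
noncomputable def ladderPoint (k : ℕ) (u : ℝ) : XSpace :=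
  ((⟨2 * k + Set.projIcc 0 1 zero_le_one u, k, by
    have := (Set.projIcc (0 : ℝ) 1 zero_le_one u).2
    constructor <;> linarith [this.1, this.2]⟩ : Ybase) : XSpace)

lemma continuous_ladderPoint (k : ℕ) : Continuous (ladderPoint k) := by
  unfold ladderPoint
  refine OnePoint.continuous_coe.comp (Continuous.subtype_mk ?_ _)
  exact continuous_const.add (continuous_subtype_val.comp continuous_projIcc)

lemma ladderPoint_eq {k : ℕ} {u : ℝ} (h0 : 0 ≤ u) (h1 : u ≤ 1) :
    ∃ h, ladderPoint k u = ((⟨2 * k + u, h⟩ : Ybase) : XSpace) := by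
  refine ⟨⟨k, by constructor <;> linarith⟩, ?_⟩
  unfold ladderPoint
  simp only [Set.projIcc_of_mem zero_le_one (Set.mem_Icc.2 ⟨h0, h1⟩)]

lemma exists_eq_ladderPoint (y : Ybase) :
    ∃ k u, 0 ≤ u ∧ u ≤ 1 ∧ (y : XSpace) = ladderPoint k u := by
  obtain ⟨y, k, hk⟩ := y
  have h0 : 0 ≤ y - 2 * k := by linarith [hk.1]
  have h1 : y - 2 * k ≤ 1 := by linarith [hk.2]
  refine ⟨k, y - 2 * k, h0, h1, ?_⟩
  obtain ⟨h, e⟩ := ladderPoint_eq (k := k) h0 h1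
  rw [e]
  congr 2
  ring

variable {r ρ : ℝ} {k : ℕ} {u : ℝ}

lemma refl_mem_Hrel (a : XSpace) : (a, a) ∈ Hrel r ρ := by
  induction a using OnePoint.rec with
  | infty => exact Or.inr rfl
  | coe y => exact Or.inl (Or.inr ⟨y, rfl⟩)

lemma up_mem_Hrel (h0 : 0 ≤ u) (h1 : u ≤ 1) :
    (ladderPoint k u, ladderPoint (k + 1) u) ∈ Hrel r ρ := by
  obtain ⟨_, e⟩ := ladderPoint_eq (k := k) h0 h1
  obtain ⟨_, e'⟩ := ladderPoint_eq (k := k + 1) h0 h1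
  rw [e, e']
  exact Or.inl (Or.inl (Or.inl (Or.inr ⟨_, _, by push_cast; ring, rfl⟩)))

lemma down_mem_Hrel (h0 : 0 ≤ u) (h1 : u ≤ 1) :
    (ladderPoint (k + 1) u, ladderPoint k u) ∈ Hrel r ρ := by
  obtain ⟨_, e⟩ := ladderPoint_eq (k := k) h0 h1
  obtain ⟨_, e'⟩ := ladderPoint_eq (k := k + 1) h0 h1
  rw [e, e']
  refine Or.inl (Or.inl (Or.inr ⟨_, _, ?_, ?_, rfl⟩))
  · push_cast
    linarith [(Nat.cast_nonneg k : (0 : ℝ) ≤ k)]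
  · push_cast
    ring

lemma contract_mem_Hrel (hr0 : 0 ≤ r) (hr1 : r ≤ 1) (h0 : 0 ≤ u) (h1 : u ≤ 1) :
    (ladderPoint 0 u, ladderPoint 0 (r * u)) ∈ Hrel r ρ := by
  obtain ⟨_, e⟩ := ladderPoint_eq (k := 0) h0 h1
  obtain ⟨_, e'⟩ := ladderPoint_eq (k := 0) (mul_nonneg hr0 h0) (mul_le_one₀ hr1 h0 h1)
  rw [e, e']
  exact Or.inl (Or.inl (Or.inl (Or.inl (Or.inl ⟨_, _, by simpa using h1, by simp, rfl⟩))))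

lemma expand_mem_Hrel (hρ : 1 ≤ ρ) (h0 : 0 ≤ u) (h1 : ρ * u ≤ 1) :
    (ladderPoint 0 u, ladderPoint 0 (ρ * u)) ∈ Hrel r ρ := by
  have hu : u ≤ 1 := (le_mul_of_one_le_left h0 hρ).trans h1
  obtain ⟨_, e⟩ := ladderPoint_eq (k := 0) h0 hu
  obtain ⟨_, e'⟩ := ladderPoint_eq (k := 0) (mul_nonneg (zero_le_one.trans hρ) h0) h1
  rw [e, e']
  exact Or.inl (Or.inl (Or.inl (Or.inl (Or.inr
    ⟨_, _, by simpa using hu, by simpa using h1, by simp, rfl⟩))))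

lemma level_eq {k l : ℕ} {t s : ℝ} (h0 : 0 ≤ t) (h1 : t ≤ 1) (h0' : 0 ≤ s) (h1' : s ≤ 1)
    (h : 2 * (k : ℝ) + t = 2 * l + s) : k = l := by
  have h2 : (k : ℝ) < l + 1 := by linarith
  have h3 : (l : ℝ) < k + 1 := by linarith
  have h2' : k < l + 1 := by exact_mod_cast h2
  have h3' : l < k + 1 := by exact_mod_cast h3
  omega

/-- Every step of `H` multiplies the fibre coordinate by a positive factor, and the same step is
available from every other point of the same level as long as the factor allows it. -/
lemma exists_factor_of_mem_Hrel (hr0 : 0 < r) (hr1 : r ≤ 1) (hρ : 1 ≤ ρ) {l : ℕ} {t s : ℝ}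
    (ht0 : 0 ≤ t) (ht1 : t ≤ 1) (hs0 : 0 ≤ s) (hs1 : s ≤ 1)
    (h : (ladderPoint k t, ladderPoint l s) ∈ Hrel r ρ) :
    ∃ d, 0 < d ∧ s = d * t ∧ ∀ u, 0 ≤ u → u ≤ 1 → d * u ≤ 1 →
      (ladderPoint k u, ladderPoint l (d * u)) ∈ Hrel r ρ := by
  obtain ⟨_, e⟩ := ladderPoint_eq (k := k) ht0 ht1
  obtain ⟨_, e'⟩ := ladderPoint_eq (k := l) hs0 hs1
  rw [e, e'] at h
  have hk0 : (0 : ℝ) ≤ k := Nat.cast_nonneg k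
  rcases h with
    ((((⟨y, z, hy, hz, hp⟩ | ⟨y, z, hy, hρy, hz, hp⟩) | ⟨y, z, hz, hp⟩) | ⟨y, z, hy, hz, hp⟩) |
      ⟨y, hp⟩) | hp
  · obtain ⟨hy', hz'⟩ := Prod.mk.inj hp
    rw [OnePoint.coe_eq_coe] at hy' hz'
    subst hy' hz'
    simp only at hy hz
    have hk : k = 0 := by
      have : (k : ℝ) < 1 := by linarith
      have : k < 1 := by exact_mod_cast this
      omega
    subst hk
    have hl : l = 0 := level_eq hs0 hs1 (mul_nonneg hr0.le ht0) (mul_le_one₀ hr1 ht0 ht1)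
      (by simpa using hz)
    subst hl
    exact ⟨r, hr0, by simpa using hz, fun u h0 h1 _ => contract_mem_Hrel hr0.le hr1 h0 h1⟩
  · obtain ⟨hy', hz'⟩ := Prod.mk.inj hp
    rw [OnePoint.coe_eq_coe] at hy' hz'
    subst hy' hz'
    simp only at hy hz hρy
    have hk : k = 0 := by
      have : (k : ℝ) < 1 := by linarith
      have : k < 1 := by exact_mod_cast this
      omega
    subst hk
    have hρ0 : 0 < ρ := by linarith
    have hl : l = 0 := level_eq hs0 hs1 (mul_nonneg hρ0.le ht0) (by simpa using hρy)
      (by simpa using hz)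
    subst hl
    exact ⟨ρ, hρ0, by simpa using hz, fun u h0 _ h1 => expand_mem_Hrel hρ h0 h1⟩
  · obtain ⟨hy', hz'⟩ := Prod.mk.inj hp
    rw [OnePoint.coe_eq_coe] at hy' hz'
    subst hy' hz'
    simp only at hz
    have hl : l = k + 1 := level_eq hs0 hs1 ht0 ht1 (by push_cast; linarith)
    subst hl
    refine ⟨1, one_pos, by push_cast at hz; linarith, fun u h0 h1 _ => ?_⟩
    rw [one_mul]
    exact up_mem_Hrel h0 h1
  · obtain ⟨hy', hz'⟩ := Prod.mk.inj hp
    rw [OnePoint.coe_eq_coe] at hy' hz'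
    subst hy' hz'
    simp only at hy hz
    have hk : k = l + 1 := level_eq ht0 ht1 hs0 hs1 (by push_cast; linarith)
    subst hk
    refine ⟨1, one_pos, by push_cast at hz; linarith, fun u h0 h1 _ => ?_⟩
    rw [one_mul]
    exact down_mem_Hrel h0 h1
  · obtain ⟨hy', hz'⟩ := Prod.mk.inj hp
    have hyz := hy'.trans hz'.symm
    rw [OnePoint.coe_eq_coe, Subtype.mk.injEq] at hyz
    have hl : k = l := level_eq ht0 ht1 hs0 hs1 hyz
    subst hl
    refine ⟨1, one_pos, by linarith, fun u _ _ _ => ?_⟩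
    rw [one_mul]
    exact refl_mem_Hrel _
  · exact absurd (Prod.mk.inj hp).1 (OnePoint.coe_ne_infty _)

/-- An orbit of `H` that avoids `∞` can be rescaled. -/
lemma exists_scaling (hr0 : 0 < r) (hr1 : r ≤ 1) (hρ : 1 ≤ ρ) {x : ℕ → XSpace}
    (hx : x ∈ MahavierPlus (Hrel r ρ)) (hinf : ∀ i, x i ≠ OnePoint.infty) :
    ∃ (κ : ℕ → ℕ) (c : ℕ → ℝ) (t : ℝ), c 0 = 1 ∧ (∀ i, 0 < c i) ∧ 0 ≤ t ∧
      (∀ i, c i * t ≤ 1) ∧ (∀ i, x i = ladderPoint (κ i) (c i * t)) ∧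
      ∀ i u, 0 ≤ u → c i * u ≤ 1 → c (i + 1) * u ≤ 1 →
        (ladderPoint (κ i) (c i * u), ladderPoint (κ (i + 1)) (c (i + 1) * u)) ∈ Hrel r ρ := by
  have hrep : ∀ i, ∃ k u, 0 ≤ u ∧ u ≤ 1 ∧ x i = ladderPoint k u := fun i => by
    obtain ⟨y, hy⟩ := OnePoint.ne_infty_iff_exists.1 (hinf i)
    rw [← hy]
    exact exists_eq_ladderPoint y
  choose κ τ hτ0 hτ1 hκ using hrep
  have hstep := fun i => exists_factor_of_mem_Hrel hr0 hr1 hρ (hτ0 i) (hτ1 i) (hτ0 (i + 1))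
    (hτ1 (i + 1)) (by rw [← hκ, ← hκ]; exact hx i)
  choose d hd0 hd hdmem using hstep
  have hc : ∀ i, (∏ j ∈ Finset.range i, d j) * τ 0 = τ i := fun i => by
    induction i with
    | zero => simp
    | succ i ih => rw [Finset.prod_range_succ, hd i, ← ih]; ring
  have hpos : ∀ i, 0 < ∏ j ∈ Finset.range i, d j := fun i => Finset.prod_pos fun j _ => hd0 j
  refine ⟨κ, fun i => ∏ j ∈ Finset.range i, d j, τ 0, by simp, hpos, hτ0 0,
    fun i => (hc i).trans_le (hτ1 i), fun i => by rw [hc i, hκ i], fun i u hu h1 h2 => ?_⟩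
  have e : (∏ j ∈ Finset.range (i + 1), d j) * u = d i * ((∏ j ∈ Finset.range i, d j) * u) := by
    rw [Finset.prod_range_succ]
    ring
  simp only [e] at h2 ⊢
  exact hdmem i _ (mul_nonneg (hpos i).le hu) h1 h2

/-- The scaling parameters that keep a finite chain inside prescribed open sets and its fibre
coordinates inside `(0, 1)` form a nonempty open set. -/
lemma isOpen_and_nonempty_scaling {κ : ℕ → ℕ} {c : ℕ → ℝ} {t : ℝ} (M : ℕ) (ht : 0 ≤ t)
    (hct : ∀ i, c i * t ≤ 1) {A : ℕ → Set XSpace} (hA : ∀ i, IsOpen (A i))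
    (htA : ∀ i ≤ M, ladderPoint (κ i) (c i * t) ∈ A i) :
    IsOpen {u : ℝ | 0 < u ∧ ∀ i ≤ M, c i * u < 1 ∧ ladderPoint (κ i) (c i * u) ∈ A i} ∧
    {u : ℝ | 0 < u ∧ ∀ i ≤ M, c i * u < 1 ∧ ladderPoint (κ i) (c i * u) ∈ A i}.Nonempty := by
  have hcont : ∀ i, Continuous fun u => ladderPoint (κ i) (c i * u) := fun i =>
    (continuous_ladderPoint _).comp (by fun_prop)
  constructor
  · have := (Set.finite_Iic M).isOpen_biInter (f := fun i =>
      {u : ℝ | c i * u < 1 ∧ ladderPoint (κ i) (c i * u) ∈ A i}) fun i _ =>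
      (isOpen_lt (continuous_const_mul (c i)) continuous_const).and ((hA i).preimage (hcont i))
    convert (isOpen_Ioi (a := (0 : ℝ))).inter this using 1
    ext u
    simp
  · obtain ⟨ε, hε, hε0⟩ : ∃ ε : ℝ, (∀ i ∈ Set.Iic M, c i * ε < 1) ∧ 0 < ε := by
      have h1 : ∀ᶠ ε : ℝ in 𝓝[>] 0, ∀ i ∈ Set.Iic M, c i * ε < 1 := by
        refine nhdsWithin_le_nhds ((eventually_all_finite (Set.finite_Iic M)).2 fun i _ => ?_)
        exact (isOpen_lt (by fun_prop) continuous_const).mem_nhds (by simp)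
      exact (h1.and self_mem_nhdsWithin).exists
    have hlim : ∀ᶠ s : ℝ in 𝓝[>] 0, ∀ i ∈ Set.Iic M,
        ladderPoint (κ i) (c i * ((1 - s) * t + s * ε)) ∈ A i := by
      refine nhdsWithin_le_nhds ((eventually_all_finite (Set.finite_Iic M)).2 fun i hi => ?_)
      exact ((hA i).preimage ((hcont i).comp (g := fun u => ladderPoint (κ i) (c i * u))
        (f := fun s => (1 - s) * t + s * ε) (by fun_prop))).mem_nhds (by simpa using htA i hi)
    obtain ⟨s, ⟨hsA, hs0⟩, hs1⟩ := ((hlim.and self_mem_nhdsWithin).and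
      (nhdsWithin_le_nhds (Iio_mem_nhds (zero_lt_one' ℝ)))).exists
    have hs0 : 0 < s := hs0
    have h1s : 0 < 1 - s := by linarith
    refine ⟨(1 - s) * t + s * ε, by positivity, fun i hi => ⟨?_, hsA i hi⟩⟩
    nlinarith [hct i, hε i hi]

lemma reflTransGen_ladderPoint_zero (h0 : 0 ≤ u) (h1 : u ≤ 1) :
    Relation.ReflTransGen (fun a b => (a, b) ∈ Hrel r ρ) (ladderPoint k u) (ladderPoint 0 u) := by
  induction k with
  | zero => rfl
  | succ k ih => exact ih.head (down_mem_Hrel h0 h1)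

lemma reflTransGen_zero_ladderPoint (h0 : 0 ≤ u) (h1 : u ≤ 1) :
    Relation.ReflTransGen (fun a b => (a, b) ∈ Hrel r ρ) (ladderPoint 0 u) (ladderPoint k u) := by
  induction k with
  | zero => rfl
  | succ k ih => exact ih.tail (up_mem_Hrel h0 h1)

lemma reflTransGen_contract (hr0 : 0 ≤ r) (hr1 : r ≤ 1) (h0 : 0 ≤ u) (h1 : u ≤ 1) (a : ℕ) :
    Relation.ReflTransGen (fun a b => (a, b) ∈ Hrel r ρ) (ladderPoint 0 u)
      (ladderPoint 0 (r ^ a * u)) := by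
  induction a with
  | zero => simpa using Relation.ReflTransGen.refl
  | succ a ih =>
    rw [pow_succ', mul_assoc]
    exact ih.tail (contract_mem_Hrel hr0 hr1 (by positivity)
      (mul_le_one₀ (pow_le_one₀ hr0 hr1) h0 h1))

lemma reflTransGen_expand (hρ : 1 ≤ ρ) (h0 : 0 ≤ u) (b : ℕ) (h1 : ρ ^ b * u ≤ 1) :
    Relation.ReflTransGen (fun a b => (a, b) ∈ Hrel r ρ) (ladderPoint 0 u)
      (ladderPoint 0 (ρ ^ b * u)) := by
  induction b with
  | zero => simpa using Relation.ReflTransGen.refl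
  | succ b ih =>
    rw [pow_succ', mul_assoc] at h1 ⊢
    have hρ0 : 0 ≤ ρ := zero_le_one.trans hρ
    have hb : 0 ≤ ρ ^ b * u := by positivity
    exact (ih ((le_mul_of_one_le_left hb hρ).trans h1)).tail (expand_mem_Hrel hρ hb h1)

end Points

section Windows

open Filter Topology

variable {r ρ : ℝ}

instance noncompactSpace_Ybase : NoncompactSpace Ybase := by
  rw [← not_compactSpace_iff, ← isCompact_iff_compactSpace]
  intro h
  obtain ⟨C, hC⟩ := h.bddAbove
  obtain ⟨n, hn⟩ := exists_nat_gt C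
  have := hC (show (2 * (n : ℝ)) ∈ Ybase from ⟨n, by constructor <;> linarith⟩)
  linarith [(Nat.cast_nonneg n : (0 : ℝ) ≤ n)]

lemma ne_infty_of_mem_MahavierPlus {x : ℕ → XSpace} (hx : x ∈ MahavierPlus (Hrel r ρ)) (i : ℕ) :
    x i = OnePoint.infty ↔ x 0 = OnePoint.infty := by
  have step : ∀ a b : XSpace, (a, b) ∈ Hrel r ρ → (b = OnePoint.infty ↔ a = OnePoint.infty) := by
    rintro a b (((((⟨y, z, -, -, hp⟩ | ⟨y, z, -, -, -, hp⟩) | ⟨y, z, -, hp⟩) |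
      ⟨y, z, -, -, hp⟩) | ⟨y, hp⟩) | hp) <;> obtain ⟨rfl, rfl⟩ := Prod.mk.inj hp <;> simp
  induction i with
  | zero => rfl
  | succ i ih => exact (step _ _ (hx i)).trans ih

/-- A finite window of an orbit can be realised by an orbit avoiding `∞`. -/
lemma exists_finite_orbit_mem (M : ℕ) {x : ℕ → XSpace} (hx : x ∈ MahavierPlus (Hrel r ρ))
    {A : ℕ → Set XSpace} (hA : ∀ i, IsOpen (A i)) (hxA : ∀ i ≤ M, x i ∈ A i) :
    ∃ x' ∈ MahavierPlus (Hrel r ρ), (∀ i, x' i ≠ OnePoint.infty) ∧ ∀ i ≤ M, x' i ∈ A i := by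
  by_cases h : x 0 = OnePoint.infty
  · have hinf := fun i => (ne_infty_of_mem_MahavierPlus hx i).2 h
    have hop : IsOpen (⋂ i ∈ Set.Iic M, A i) :=
      (Set.finite_Iic M).isOpen_biInter fun i _ => hA i
    obtain ⟨y, hy⟩ := OnePoint.denseRange_coe.exists_mem_open hop
      ⟨OnePoint.infty, by simpa using fun i hi => hinf i ▸ hxA i hi⟩
    exact ⟨fun _ => y, fun _ => refl_mem_Hrel _, fun _ => OnePoint.coe_ne_infty _,
      by simpa using hy⟩
  · exact ⟨x, hx, fun i hi => h ((ne_infty_of_mem_MahavierPlus hx i).1 hi), hxA⟩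

/-- Specification for finite windows: two windows of orbits of `H` are visited, at any
sufficiently large time distance, by a single two-sided orbit. -/
lemma exists_orbit_through_windows (hNC : NeverConnect r ρ) (M : ℕ) {x y : ℕ → XSpace}
    (hx : x ∈ MahavierPlus (Hrel r ρ)) (hy : y ∈ MahavierPlus (Hrel r ρ))
    {A B : ℕ → Set XSpace} (hA : ∀ i, IsOpen (A i)) (hB : ∀ i, IsOpen (B i))
    (hxA : ∀ i ≤ M, x i ∈ A i) (hyB : ∀ i ≤ M, y i ∈ B i) :
    ∃ n₀ : ℕ, ∀ n, n₀ ≤ n → ∃ z ∈ MahavierTwo (Hrel r ρ),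
      (∀ i : ℕ, i ≤ M → z i ∈ A i) ∧ ∀ i : ℕ, i ≤ M → z ((n + i : ℕ) : ℤ) ∈ B i := by
  have hr0 := hNC.1
  have hr1 := hNC.2.1.le
  have hρ := hNC.2.2.1.le
  obtain ⟨x, hx, hxinf, hxA⟩ := exists_finite_orbit_mem M hx hA hxA
  obtain ⟨y, hy, hyinf, hyB⟩ := exists_finite_orbit_mem M hy hB hyB
  obtain ⟨κ, c, t, -, hc, ht, hct, hxc, hchain⟩ := exists_scaling hr0 hr1 hρ hx hxinf
  obtain ⟨κ', c', t', hc0', -, ht', hct', hyc, hchain'⟩ := exists_scaling hr0 hr1 hρ hy hyinf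
  obtain ⟨-, u, hu0, hu⟩ := isOpen_and_nonempty_scaling M ht hct hA
    (κ := κ) fun i hi => hxc i ▸ hxA i hi
  obtain ⟨hO, v, hv⟩ := isOpen_and_nonempty_scaling M ht' hct' hB
    (κ := κ') fun i hi => hyc i ▸ hyB i hi
  have hs0 : 0 < c M * u := mul_pos (hc M) hu0
  have hs1 : c M * u ≤ 1 := (hu M le_rfl).1.le
  obtain ⟨a, b, hw0, hw⟩ := exists_pow_mul_pow_mul_mem hNC hs0 hv.1 hO hv
  set w := ρ ^ b * (r ^ a * (c M * u))
  have hw1 : w ≤ 1 := by simpa [hc0'] using (hw 0 (Nat.zero_le M)).1.le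
  have hconn : Relation.ReflTransGen (fun a b => (a, b) ∈ Hrel r ρ)
      (ladderPoint (κ M) (c M * u)) (ladderPoint (κ' 0) (c' 0 * w)) := by
    rw [hc0', one_mul]
    exact (((reflTransGen_ladderPoint_zero hs0.le hs1).trans
      (reflTransGen_contract hr0.le hr1 hs0.le hs1 a)).trans
      (reflTransGen_expand hρ (by positivity) b hw1)).trans
      (reflTransGen_zero_ladderPoint hw0.le hw1)
  obtain ⟨N, hN⟩ := exists_hasPath_of_reflTransGen refl_mem_Hrel hconn
  refine ⟨M + N, fun n hn => ?_⟩
  obtain ⟨L, rfl⟩ := Nat.exists_eq_add_of_le ((Nat.le_add_right M N).trans hn)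
  obtain ⟨z, hz, hzA, hzB⟩ := exists_orbit_of_chains refl_mem_Hrel
    (p := fun i => ladderPoint (κ i) (c i * u)) (w := fun i => ladderPoint (κ' i) (c' i * w))
    (fun i hi => hchain i u hu0.le (hu i hi.le).1.le (hu (i + 1) hi).1.le)
    (fun i hi => hchain' i w hw0.le (hw i hi.le).1.le (hw (i + 1) hi).1.le)
    (hN L (by omega))
  exact ⟨z, hz, fun i hi => by rw [hzA i hi]; exact (hu i hi).2,
    fun i hi => by rw [hzB i hi]; exact (hw i hi).2⟩

end Windows

section Shifts

variable {X : Type} {F : Set (X × X)}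

lemma shiftPlus_iterate_apply (n : ℕ) (x : MahavierPlus F) (i : ℕ) :
    ((shiftPlus F)^[n] x).1 i = x.1 (n + i) := by
  induction n generalizing x with
  | zero => simp
  | succ n ih =>
    rw [Function.iterate_succ_apply, ih]
    exact congrArg x.1 (by omega)

lemma shiftTwo_iterate_apply (n : ℕ) (x : MahavierTwo F) (i : ℤ) :
    ((shiftTwo F)^[n] x).1 i = x.1 (n + i) := by
  induction n generalizing x with
  | zero => simp
  | succ n ih =>
    rw [Function.iterate_succ_apply, ih]
    exact congrArg x.1 (by push_cast; omega)

variable {ι : Type} [TopologicalSpace X]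

/-- A neighbourhood in a subspace of a product contains a cylinder. -/
lemma exists_cylinder_subset {S : Set (ι → X)} {U : Set S} (hU : IsOpen U) {x : S} (hx : x ∈ U) :
    ∃ (I : Finset ι) (A : ι → Set X), (∀ i, IsOpen (A i)) ∧ (∀ i, x.1 i ∈ A i) ∧
      ∀ z : S, (∀ i ∈ I, z.1 i ∈ A i) → z ∈ U := by
  classical
  obtain ⟨U', hU', rfl⟩ := isOpen_induced_iff.1 hU
  obtain ⟨I, A, hA, hsub⟩ := isOpen_pi_iff.1 hU' x.1 hx
  refine ⟨I, fun i => if i ∈ I then A i else Set.univ, fun i => ?_, fun i => ?_,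
    fun z hz => hsub fun i hi => ?_⟩
  · by_cases hi : i ∈ I
    · simpa [hi] using (hA i hi).1
    · simp [hi]
  · by_cases hi : i ∈ I
    · simpa [hi] using (hA i hi).2
    · simp [hi]
  · have hi' : i ∈ I := hi
    simpa [hi'] using hz i hi'

end Shifts

lemma topologicallyMixing_shiftPlus {r ρ : ℝ} (hNC : NeverConnect r ρ) :
    TopologicallyMixing (shiftPlus (Hrel r ρ)) := by
  rintro U V hU hV ⟨x, hx⟩ ⟨y, hy⟩
  obtain ⟨I, A, hA, hxA, hAU⟩ := exists_cylinder_subset hU hx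
  obtain ⟨J, B, hB, hyB, hBV⟩ := exists_cylinder_subset hV hy
  obtain ⟨n₀, hn₀⟩ := exists_orbit_through_windows hNC ((I ∪ J).sup id) x.2 y.2 hA hB
    (fun i _ => hxA i) (fun i _ => hyB i)
  have hle : ∀ i ∈ I ∪ J, i ≤ (I ∪ J).sup id := fun i hi => Finset.le_sup (f := id) hi
  refine ⟨n₀, fun n hn => ?_⟩
  obtain ⟨z, hz, hzA, hzB⟩ := hn₀ n hn
  refine ⟨_, ⟨⟨fun i => z i, fun i => by exact_mod_cast hz i⟩, hAU _ fun i hi => ?_, rfl⟩,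
    hBV _ fun i hi => ?_⟩
  · exact hzA i (hle i (Finset.mem_union_left _ hi))
  · rw [shiftPlus_iterate_apply]
    exact hzB i (hle i (Finset.mem_union_right _ hi))

lemma topologicallyMixing_shiftTwo {r ρ : ℝ} (hNC : NeverConnect r ρ) :
    TopologicallyMixing (shiftTwo (Hrel r ρ)) := by
  rintro U V hU hV ⟨x, hx⟩ ⟨y, hy⟩
  obtain ⟨I, A, hA, hxA, hAU⟩ := exists_cylinder_subset hU hx
  obtain ⟨J, B, hB, hyB, hBV⟩ := exists_cylinder_subset hV hy
  set K := (I ∪ J).sup Int.natAbs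
  have hle : ∀ i ∈ I ∪ J, i.natAbs ≤ K := fun i hi => Finset.le_sup hi
  have hwin : ∀ x ∈ MahavierTwo (Hrel r ρ),
      (fun i : ℕ => x ((i : ℤ) - K)) ∈ MahavierPlus (Hrel r ρ) := fun x hx i => by
    have := hx ((i : ℤ) - K)
    rwa [show (i : ℤ) - K + 1 = ((i + 1 : ℕ) : ℤ) - K by push_cast; ring] at this
  obtain ⟨n₀, hn₀⟩ := exists_orbit_through_windows hNC (2 * K) (hwin _ x.2) (hwin _ y.2)
    (A := fun i => A ((i : ℤ) - K)) (B := fun i => B ((i : ℤ) - K)) (fun i => hA _)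
    (fun i => hB _) (fun i _ => hxA _) (fun i _ => hyB _)
  refine ⟨n₀, fun n hn => ?_⟩
  obtain ⟨z, hz, hzA, hzB⟩ := hn₀ n hn
  refine ⟨_, ⟨⟨fun i => z (i + K), fun i => ?_⟩, hAU _ fun i hi => ?_, rfl⟩, hBV _ fun i hi => ?_⟩
  · simpa only [add_right_comm] using hz (i + K)
  · have hi' := hle i (Finset.mem_union_left _ hi)
    obtain ⟨j, hj⟩ := Int.eq_ofNat_of_zero_le (show 0 ≤ i + K by omega)
    have := hzA j (by omega)
    rwa [← hj, add_sub_cancel_right] at this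
  · have hi' := hle i (Finset.mem_union_right _ hi)
    obtain ⟨j, hj⟩ := Int.eq_ofNat_of_zero_le (show 0 ≤ i + K by omega)
    have := hzB j (by omega)
    rw [shiftTwo_iterate_apply]
    rwa [Nat.cast_add, ← hj, add_sub_cancel_right, ← add_assoc] at this

/-- For `(r,ρ) ∈ 𝒩𝒞`, the dynamical systems `(𝕏_H⁺, σ_H⁺)` and `(𝕏_H, σ_H)` are
topologically mixing. -/
theorem statement13 (r ρ : ℝ) (hNC : NeverConnect r ρ) :
    TopologicallyMixing (shiftPlus (Hrel r ρ)) ∧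
    TopologicallyMixing (shiftTwo (Hrel r ρ)) := by
  exact ⟨topologicallyMixing_shiftPlus hNC, topologicallyMixing_shiftTwo hNC⟩
end

section
/- For every (r,ρ) ∈ NC, the shift σ_H^+ induces a well-defined continuous map (σ_H^+)^⋆ on 𝕏_H^+/~₁ given by [x] ↦ [σ_H^+(x)]; this map is not invertible (it is not a homeomorphism), and the dynamical system (𝕏_H^+/~₁, (σ_H^+)^⋆) is topologically mixing. -/
/-- A point of `𝕏` lying in `{0, 2, 4, 6, …}`. -/
def IsEvenPt (a : XSpace) : Prop :=
  ∃ (m : ℕ) (h : (2*(m:ℝ)) ∈ Ybase), a = ((⟨2*(m:ℝ), h⟩ : Ybase) : XSpace)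

/-- The relation `~₁` on `𝕏_H⁺`: `x ~₁ y` iff `x = y` or all coordinates of both `x` and
`y` lie in `{0,2,4,6,…}`. -/
def relOne (r ρ : ℝ) (x y : ↥(MahavierPlus (Hrel r ρ))) : Prop :=
  x = y ∨ ∀ i : ℕ, IsEvenPt (x.1 i) ∧ IsEvenPt (y.1 i)

/-- The relation `~₂` on `𝕏_H`: `x ~₂ y` iff `x = y` or all coordinates of both `x` and
`y` lie in `{0,2,4,6,…}`. -/
def relTwo (r ρ : ℝ) (x y : ↥(MahavierTwo (Hrel r ρ))) : Prop :=
  x = y ∨ ∀ i : ℤ, IsEvenPt (x.1 i) ∧ IsEvenPt (y.1 i)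

open Filter Topology Set

section Mahavier

variable {X : Type} {F : Set (X × X)}

/-- `Leads F n a b` says that every forward `F`-orbit of `b` is the `n`-th shift of a forward
`F`-orbit of `a`. -/
def Leads (F : Set (X × X)) (n : ℕ) (a b : X) : Prop :=
  ∀ x ∈ MahavierPlus F, x 0 = b → ∃ y ∈ MahavierPlus F, y 0 = a ∧ ∀ i, y (i + n) = x i

theorem Leads.refl (a : X) : Leads F 0 a a := fun x hx h => ⟨x, hx, h, fun _ => rfl⟩

theorem Leads.trans {m n : ℕ} {a b c : X} (h₁ : Leads F m a b) (h₂ : Leads F n b c) :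
    Leads F (m + n) a c := by
  intro x hx hx0
  obtain ⟨y, hy, hy0, hyx⟩ := h₂ x hx hx0
  obtain ⟨z, hz, hz0, hzy⟩ := h₁ y hy hy0
  refine ⟨z, hz, hz0, fun i => ?_⟩
  rw [add_comm m n, ← add_assoc, hzy, hyx]

theorem Leads.single {a b : X} (h : (a, b) ∈ F) : Leads F 1 a b := by
  intro x hx hx0
  refine ⟨fun i => i.casesOn a x, ?_, rfl, fun _ => rfl⟩
  rintro (_ | i)
  · simpa [hx0] using h
  · exact hx i

theorem Leads.stay {a : X} (h : (a, a) ∈ F) (n : ℕ) : Leads F n a a := by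
  induction n with
  | zero => exact Leads.refl a
  | succ n ih => exact ih.trans (Leads.single h)

/-- Concatenation of an initial segment of an orbit with an orbit of its endpoint. -/
theorem exists_mahavierPlus_append {u x : ℕ → X} (hu : u ∈ MahavierPlus F)
    (hx : x ∈ MahavierPlus F) (m : ℕ) (h : x 0 = u m) :
    ∃ y ∈ MahavierPlus F, (∀ i ≤ m, y i = u i) ∧ ∀ i, y (i + m) = x i := by
  refine ⟨fun i => if i ≤ m then u i else x (i - m), fun i => ?_, fun i hi => if_pos hi,
    fun i => ?_⟩
  · rcases lt_trichotomy i m with hi | rfl | hi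
    · simpa [hi.le, Nat.succ_le_of_lt hi] using hu i
    · simpa [h] using hx 0
    · have h₁ : ¬ i ≤ m := by omega
      have h₂ : ¬ i + 1 ≤ m := by omega
      have h₃ : i + 1 - m = i - m + 1 := by omega
      simpa [h₁, h₂, h₃] using hx (i - m)
  · rcases i with _ | i
    · simp [h]
    · simp

theorem iterate_shiftPlus_apply (n : ℕ) (x : MahavierPlus F) (i : ℕ) :
    ((shiftPlus F)^[n] x).1 i = x.1 (i + n) := by
  induction n generalizing x with
  | zero => rfl
  | succ n ih =>
    rw [Function.iterate_succ_apply, ih]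
    exact congrArg x.1 (by omega)

variable [TopologicalSpace X]

theorem continuous_shiftPlus : Continuous (shiftPlus F) :=
  continuous_induced_rng.2 <|
    continuous_pi fun i => (continuous_apply (i + 1)).comp continuous_subtype_val

/-- An open set containing `u` contains every orbit that agrees with `u` for long enough. -/
theorem exists_forall_agree_mem {U : Set (MahavierPlus F)} (hU : IsOpen U) {u : MahavierPlus F}
    (hu : u ∈ U) : ∃ m : ℕ, ∀ w : MahavierPlus F, (∀ i ≤ m, w.1 i = u.1 i) → w ∈ U := by
  by_contra! hcon
  choose w hw hwU using hcon
  have hlim : Tendsto w atTop (𝓝 u) := by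
    rw [tendsto_subtype_rng, tendsto_pi_nhds]
    intro i
    refine tendsto_const_nhds.congr' ?_
    filter_upwards [eventually_ge_atTop i] with m hm using (hw m i hm).symm
  obtain ⟨m, hm⟩ := (hlim.eventually (hU.mem_nhds hu)).exists
  exact hwU m hm

end Mahavier

theorem TopologicallyMixing.of_semiconj {X Y : Type} [TopologicalSpace X] [TopologicalSpace Y]
    {f : X → X} {g : Y → Y} {π : X → Y} (hf : TopologicallyMixing f) (hπ : Continuous π)
    (hsurj : Function.Surjective π) (h : Function.Semiconj π f g) : TopologicallyMixing g := by
  intro U V hU hV hUne hVne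
  obtain ⟨n₀, hn₀⟩ := hf _ _ (hU.preimage hπ) (hV.preimage hπ) (hUne.preimage hsurj)
    (hVne.preimage hsurj)
  refine ⟨n₀, fun n hn => ?_⟩
  obtain ⟨_, ⟨x, hx, rfl⟩, hxV⟩ := hn₀ n hn
  exact ⟨_, ⟨π x, hx, rfl⟩, by rwa [← (h.iterate_right n).eq]⟩

/-- If `p, q > 0` are incommensurable, the values `b q - a p` with `a, b ∈ ℕ` are dense in `ℝ`. -/
theorem exists_nat_mul_sub_nat_mul_mem_Ioo {p q : ℝ} (hp : 0 < p) (hq : 0 < q)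
    (h : Irrational (q / p)) {A B : ℝ} (hAB : A < B) :
    ∃ a b : ℕ, (b : ℝ) * q - a * p ∈ Ioo A B := by
  have : Fact (0 < p) := ⟨hp⟩
  have hdense := AddCircle.denseRange_zsmul_coe_iff.2 h
  obtain ⟨c, hc⟩ := exists_between hAB
  have hcl : MapClusterPt (c : AddCircle p) atTop (fun n : ℕ => n • (q : AddCircle p)) := by
    rw [mapClusterPt_atTop_nsmul_iff_mem_topologicalClosure_zmultiples]
    have : (c : AddCircle p) ∈ closure (range fun n : ℤ => n • (q : AddCircle p)) := hdense _
    rwa [← AddSubgroup.coe_zmultiples, ← AddSubgroup.topologicalClosure_coe] at this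
  have hopen : IsOpen ((fun x : ℝ => (x : AddCircle p)) '' Ioo A B) :=
    QuotientAddGroup.isOpenMap_coe _ isOpen_Ioo
  have hfreq := mapClusterPt_iff_frequently.1 hcl _ (hopen.mem_nhds ⟨c, hc, rfl⟩)
  obtain ⟨N, hN⟩ := exists_nat_gt (B / q)
  obtain ⟨b, ⟨x, hx, hxb⟩, hb⟩ := (hfreq.and_eventually (eventually_ge_atTop N)).exists
  have hdiff : ((b * q - x : ℝ) : AddCircle p) = 0 := by
    rw [AddCircle.coe_sub, sub_eq_zero, show (x : AddCircle p) = _ from hxb, ← nsmul_eq_mul, AddCircle.coe_nsmul]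
  obtain ⟨z, hz⟩ := AddCircle.coe_eq_zero_iff p |>.1 hdiff
  rw [zsmul_eq_mul] at hz
  have hbq : B < b * q := by
    rw [div_lt_iff₀ hq] at hN
    have : (N : ℝ) ≤ b := by exact_mod_cast hb
    nlinarith
  have hzpos : (0 : ℝ) < z := by
    have : 0 < (z : ℝ) * p := by rw [hz]; linarith [hx.2]
    exact pos_of_mul_pos_left this hp.le
  have hz0 : 0 ≤ z := by exact_mod_cast hzpos.le
  lift z to ℕ using hz0
  refine ⟨z, b, ?_⟩
  have : (b : ℝ) * q - z * p = x := by
    push_cast at hz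
    linarith
  rwa [this]

theorem NeverConnect.irrational {r ρ : ℝ} (h : NeverConnect r ρ) :
    Irrational (Real.log ρ / -Real.log r) := by
  obtain ⟨hr0, hr1, hρ, hnc⟩ := h
  have hlogr := Real.log_neg hr0 hr1
  rintro ⟨x, hx⟩
  have hden : (x.den : ℝ) ≠ 0 := by exact_mod_cast x.den_nz
  have hlog : Real.log (r ^ (-x.num)) = Real.log (ρ ^ (x.den : ℤ)) := by
    rw [Real.log_zpow, Real.log_zpow]
    rw [Rat.cast_def, div_eq_div_iff hden (by linarith)] at hx
    push_cast
    linarith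
  have heq := Real.log_injOn_pos (mem_Ioi.2 (zpow_pos hr0 _))
    (mem_Ioi.2 (zpow_pos (by linarith) _)) hlog
  have := ((hnc _ _).1 heq).2
  exact x.den_nz (by exact_mod_cast this)

theorem NeverConnect.exists_pow_mul_pow_mem_Ioo {r ρ : ℝ} (h : NeverConnect r ρ) {α β : ℝ}
    (hα : 0 < α) (hαβ : α < β) : ∃ a b : ℕ, ρ ^ b * r ^ a ∈ Ioo α β := by
  have hirr := h.irrational
  obtain ⟨hr0, hr1, hρ, -⟩ := h
  have hρ0 : 0 < ρ := by linarith
  obtain ⟨a, b, hab⟩ := exists_nat_mul_sub_nat_mul_mem_Ioo (neg_pos.2 (Real.log_neg hr0 hr1))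
    (Real.log_pos hρ) hirr (Real.log_lt_log hα hαβ)
  refine ⟨a, b, ?_⟩
  have hpos : 0 < ρ ^ b * r ^ a := by positivity
  have hlog : Real.log (ρ ^ b * r ^ a) = b * Real.log ρ - a * -Real.log r := by
    rw [Real.log_mul (by positivity) (by positivity), Real.log_pow, Real.log_pow]
    ring
  rw [← hlog] at hab
  exact ⟨(Real.log_lt_log_iff hα hpos).1 hab.1,
    (Real.log_lt_log_iff hpos (hα.trans hαβ)).1 hab.2⟩

/-- The point `2k + t` of `𝕏`, where `t` is clamped to `[0,1]`. -/
noncomputable def gridPoint (k : ℕ) (t : ℝ) : XSpace :=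
  ((⟨2 * k + (projIcc (0 : ℝ) 1 zero_le_one t : ℝ), k,
    by linarith [(projIcc (0 : ℝ) 1 zero_le_one t).2.1],
    by linarith [(projIcc (0 : ℝ) 1 zero_le_one t).2.2]⟩ : Ybase) : XSpace)

theorem continuous_gridPoint (k : ℕ) : Continuous (gridPoint k) :=
  OnePoint.continuous_coe.comp <| Continuous.subtype_mk
    (continuous_const.add (continuous_subtype_val.comp continuous_projIcc)) _

theorem exists_coe_eq_gridPoint (k : ℕ) {t : ℝ} (ht : t ∈ Icc (0 : ℝ) 1) :
    ∃ y : Ybase, (y : ℝ) = 2 * k + t ∧ gridPoint k t = (y : XSpace) :=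
  ⟨⟨2 * k + t, k, by linarith [ht.1], by linarith [ht.2]⟩, rfl, by
    simp only [gridPoint, projIcc_of_mem zero_le_one ht]⟩

theorem exists_eq_gridPoint (y : Ybase) :
    ∃ k : ℕ, ∃ t ∈ Icc (0 : ℝ) 1, (y : XSpace) = gridPoint k t ∧ (y : ℝ) = 2 * k + t := by
  obtain ⟨k, hk⟩ := y.2
  have ht : (y : ℝ) - 2 * k ∈ Icc (0 : ℝ) 1 := ⟨by linarith [hk.1], by linarith [hk.2]⟩
  obtain ⟨z, hz, hzk⟩ := exists_coe_eq_gridPoint k ht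
  refine ⟨k, _, ht, ?_, by ring⟩
  rw [hzk, show y = z from Subtype.ext (by rw [hz]; ring)]

theorem tendsto_gridPoint_infty : Tendsto (fun n => gridPoint n 1) atTop (𝓝 OnePoint.infty) := by
  refine OnePoint.tendsto_coe_infty.comp ?_
  rw [hasBasis_coclosedCompact.tendsto_right_iff]
  rintro K ⟨-, hK⟩
  obtain ⟨B, hB⟩ := (hK.image continuous_subtype_val).bddAbove
  obtain ⟨N, hN⟩ := exists_nat_gt B
  filter_upwards [eventually_ge_atTop N] with n hn hmem
  have h₁ := hB (mem_image_of_mem _ hmem)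
  have h₂ : (N : ℝ) ≤ n := by exact_mod_cast hn
  have h₃ := (projIcc (0 : ℝ) 1 zero_le_one 1).2.1
  simp only at h₁
  have h₄ : (0 : ℝ) ≤ n := n.cast_nonneg
  linarith

/-- The relation `H` on finite points, in the coordinates `2k + t`. -/
def GridStep (r ρ : ℝ) (k : ℕ) (t : ℝ) (l : ℕ) (s : ℝ) : Prop :=
  (k = 0 ∧ l = 0 ∧ s = r * t) ∨ (k = 0 ∧ l = 0 ∧ s = ρ * t) ∨ (l = k + 1 ∧ s = t) ∨
    (k = l + 1 ∧ s = t) ∨ (l = k ∧ s = t)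

section Grid

variable {r ρ : ℝ}

theorem GridStep.mem_Hrel {k l : ℕ} {t s : ℝ} (h : GridStep r ρ k t l s)
    (ht : t ∈ Icc (0 : ℝ) 1) (hs : s ∈ Icc (0 : ℝ) 1) :
    (gridPoint k t, gridPoint l s) ∈ Hrel r ρ := by
  obtain ⟨y, hy, hyk⟩ := exists_coe_eq_gridPoint k ht
  obtain ⟨z, hz, hzl⟩ := exists_coe_eq_gridPoint l hs
  rw [hyk, hzl]
  rcases h with ⟨rfl, rfl, rfl⟩ | ⟨rfl, rfl, rfl⟩ | ⟨rfl, rfl⟩ | ⟨rfl, rfl⟩ | ⟨rfl, rfl⟩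
  · refine .inl <| .inl <| .inl <| .inl <| .inl ⟨y, z, ?_, ?_, rfl⟩
    · rw [hy]; simpa using ht.2
    · rw [hy, hz]; simp
  · refine .inl <| .inl <| .inl <| .inl <| .inr ⟨y, z, ?_, ?_, ?_, rfl⟩
    · rw [hy]; simpa using ht.2
    · rw [hy]; simpa using hs.2
    · rw [hy, hz]; simp
  · refine .inl <| .inl <| .inl <| .inr ⟨y, z, ?_, rfl⟩
    rw [hy, hz]; push_cast; ring
  · refine .inl <| .inl <| .inr ⟨y, z, ?_, ?_, rfl⟩
    · rw [hy]; push_cast; linarith [ht.1, (l.cast_nonneg : (0 : ℝ) ≤ l)]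
    · rw [hy, hz]; push_cast; ring
  · refine .inl <| .inr ⟨y, ?_⟩
    rw [show z = y from Subtype.ext (by rw [hy, hz])]

theorem eq_of_two_mul_add_eq {k l : ℕ} {t s : ℝ} (ht : t ∈ Icc (0 : ℝ) 1)
    (hs : s ∈ Icc (0 : ℝ) 1) (h : 2 * (l : ℝ) + s = 2 * k + t) : l = k ∧ s = t := by
  have hlk : l = k := by
    have h₁ : (l : ℝ) < k + 1 := by linarith [ht.2, hs.1]
    have h₂ : (k : ℝ) < l + 1 := by linarith [ht.1, hs.2]
    norm_cast at h₁ h₂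
    omega
  subst hlk
  exact ⟨rfl, by linarith⟩

theorem gridStep_of_mem_Hrel (hr0 : 0 < r) (hr1 : r < 1) (hρ : 1 < ρ) {y z : Ybase}
    (h : ((y : XSpace), (z : XSpace)) ∈ Hrel r ρ) {k l : ℕ} {t s : ℝ}
    (ht : t ∈ Icc (0 : ℝ) 1) (hs : s ∈ Icc (0 : ℝ) 1) (hy : (y : ℝ) = 2 * k + t)
    (hz : (z : ℝ) = 2 * l + s) : GridStep r ρ k t l s := by
  have hk : (y : ℝ) ≤ 1 → k = 0 := fun h1 => by
    have : (k : ℝ) < 1 := by linarith [ht.1]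
    exact_mod_cast Nat.lt_one_iff.1 (by exact_mod_cast this)
  rcases h with ((((h | h) | h) | h) | h) | h
  · obtain ⟨y', z', hy1, hyz, he⟩ := h
    simp only [Prod.mk.injEq, OnePoint.coe_eq_coe] at he
    obtain ⟨rfl, rfl⟩ := he
    obtain rfl := hk hy1
    have hyt : (y : ℝ) = t := by simpa using hy
    rw [hz, hyt] at hyz
    have := eq_of_two_mul_add_eq (k := 0) (t := r * t)
      ⟨mul_nonneg hr0.le ht.1, by nlinarith [ht.1, ht.2]⟩ hs (by simpa using hyz)
    exact .inl ⟨rfl, this⟩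
  · obtain ⟨y', z', hy1, hy2, hyz, he⟩ := h
    simp only [Prod.mk.injEq, OnePoint.coe_eq_coe] at he
    obtain ⟨rfl, rfl⟩ := he
    obtain rfl := hk hy1
    have hyt : (y : ℝ) = t := by simpa using hy
    rw [hz, hyt] at hyz
    rw [hyt] at hy2
    have := eq_of_two_mul_add_eq (k := 0) (t := ρ * t)
      ⟨mul_nonneg (by linarith) ht.1, hy2⟩ hs (by simpa using hyz)
    exact .inr <| .inl ⟨rfl, this⟩
  · obtain ⟨y', z', hyz, he⟩ := h
    simp only [Prod.mk.injEq, OnePoint.coe_eq_coe] at he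
    obtain ⟨rfl, rfl⟩ := he
    exact .inr <| .inr <| .inl <| eq_of_two_mul_add_eq (k := k + 1) ht hs
      (by push_cast; linarith)
  · obtain ⟨y', z', -, hyz, he⟩ := h
    simp only [Prod.mk.injEq, OnePoint.coe_eq_coe] at he
    obtain ⟨rfl, rfl⟩ := he
    have := eq_of_two_mul_add_eq (k := l + 1) (l := k) hs ht (by push_cast; linarith)
    exact .inr <| .inr <| .inr <| .inl ⟨this.1, this.2.symm⟩
  · obtain ⟨y', he⟩ := h
    simp only [Prod.mk.injEq, OnePoint.coe_eq_coe] at he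
    obtain ⟨rfl, rfl⟩ := he
    exact .inr <| .inr <| .inr <| .inr <| eq_of_two_mul_add_eq ht hs (by linarith)
  · simp at h

theorem eq_infty_iff_of_mem_Hrel {a b : XSpace} (h : (a, b) ∈ Hrel r ρ) :
    a = OnePoint.infty ↔ b = OnePoint.infty := by
  rcases h with ((((h | h) | h) | h) | h) | h
  · obtain ⟨y, z, -, -, he⟩ := h
    simp_all
  · obtain ⟨y, z, -, -, -, he⟩ := h
    simp_all
  · obtain ⟨y, z, -, he⟩ := h
    simp_all
  · obtain ⟨y, z, -, -, he⟩ := h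
    simp_all
  · obtain ⟨y, he⟩ := h
    simp_all
  · simp_all

/-- `2kᵢ + tᵢ` is a forward `H`-orbit with `tᵢ ∈ [0,1]`. -/
def GridOrbit (r ρ : ℝ) (k : ℕ → ℕ) (t : ℕ → ℝ) : Prop :=
  (∀ i, t i ∈ Icc (0 : ℝ) 1) ∧ ∀ i, GridStep r ρ (k i) (t i) (k (i + 1)) (t (i + 1))

/-- The point of `𝕏_H⁺` described by a `GridOrbit`. -/
noncomputable def GridOrbit.toPlus {k : ℕ → ℕ} {t : ℕ → ℝ} (h : GridOrbit r ρ k t) :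
    MahavierPlus (Hrel r ρ) :=
  ⟨fun i => gridPoint (k i) (t i), fun i => (h.2 i).mem_Hrel (h.1 i) (h.1 (i + 1))⟩

theorem eq_infty_or_exists_gridOrbit (hr0 : 0 < r) (hr1 : r < 1) (hρ : 1 < ρ)
    (x : MahavierPlus (Hrel r ρ)) :
    (∀ i, x.1 i = OnePoint.infty) ∨ ∃ k t, ∃ h : GridOrbit r ρ k t, h.toPlus = x := by
  have hiff : ∀ i, x.1 0 = OnePoint.infty ↔ x.1 i = OnePoint.infty := by
    intro i
    induction i with
    | zero => rfl
    | succ i ih => exact ih.trans (eq_infty_iff_of_mem_Hrel (x.2 i))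
  by_cases h0 : x.1 0 = OnePoint.infty
  · exact .inl fun i => (hiff i).1 h0
  · right
    choose y hy using fun i => OnePoint.ne_infty_iff_exists.1 (mt (hiff i).2 h0)
    choose k t ht hyk hyt using fun i => exists_eq_gridPoint (y i)
    refine ⟨k, t, ⟨ht, fun i => ?_⟩, ?_⟩
    · refine gridStep_of_mem_Hrel hr0 hr1 hρ ?_ (ht i) (ht (i + 1)) (hyt i) (hyt (i + 1))
      rw [hy, hy]
      exact x.2 i
    · exact Subtype.ext (funext fun i => by rw [← hy, hyk]; rfl)

theorem GridStep.eq_zero_iff (hr0 : 0 < r) (hρ : 1 < ρ) {k l : ℕ} {t s : ℝ}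
    (h : GridStep r ρ k t l s) : t = 0 ↔ s = 0 := by
  have hρ0 : ρ ≠ 0 := by linarith
  rcases h with ⟨-, -, rfl⟩ | ⟨-, -, rfl⟩ | ⟨-, rfl⟩ | ⟨-, rfl⟩ | ⟨-, rfl⟩ <;>
    simp [hr0.ne', hρ0]

theorem GridOrbit.eq_zero_iff (hr0 : 0 < r) (hρ : 1 < ρ) {k : ℕ → ℕ} {t : ℕ → ℝ}
    (h : GridOrbit r ρ k t) (i : ℕ) : t 0 = 0 ↔ t i = 0 := by
  induction i with
  | zero => rfl
  | succ i ih => exact ih.trans ((h.2 i).eq_zero_iff hr0 hρ)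

theorem GridStep.mul_left {k l : ℕ} {t s : ℝ} (h : GridStep r ρ k t l s) (c : ℝ) :
    GridStep r ρ k (c * t) l (c * s) := by
  rcases h with ⟨rfl, rfl, rfl⟩ | ⟨rfl, rfl, rfl⟩ | ⟨rfl, rfl⟩ | ⟨rfl, rfl⟩ | ⟨rfl, rfl⟩
  · exact .inl ⟨rfl, rfl, by ring⟩
  · exact .inr <| .inl ⟨rfl, rfl, by ring⟩
  · exact .inr <| .inr <| .inl ⟨rfl, rfl⟩
  · exact .inr <| .inr <| .inr <| .inl ⟨rfl, rfl⟩
  · exact .inr <| .inr <| .inr <| .inr ⟨rfl, rfl⟩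

theorem GridOrbit.mul_left {k : ℕ → ℕ} {t : ℕ → ℝ} (h : GridOrbit r ρ k t) {c : ℝ}
    (hc : c ∈ Icc (0 : ℝ) 1) : GridOrbit r ρ k (fun i => c * t i) :=
  ⟨fun i => ⟨mul_nonneg hc.1 (h.1 i).1, mul_le_one₀ hc.2 (h.1 i).1 (h.1 i).2⟩,
    fun i => (h.2 i).mul_left c⟩

theorem GridStep.const {k l : ℕ} (h : GridStep r ρ k 0 l 0) (s : ℝ) : GridStep r ρ k s l s := by
  unfold GridStep at *
  simp only [and_true, mul_zero] at *
  omega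

/-- Orbits in `𝕏_H⁺` that avoid both `∞` and the even integers are dense. -/
theorem exists_pos_gridOrbit_mem (hr0 : 0 < r) (hr1 : r < 1) (hρ : 1 < ρ)
    {U : Set (MahavierPlus (Hrel r ρ))} (hU : IsOpen U) (hne : U.Nonempty) :
    ∃ k t, ∃ h : GridOrbit r ρ k t, h.toPlus ∈ U ∧ ∀ i, 0 < t i := by
  obtain ⟨x, hx⟩ := hne
  rcases eq_infty_or_exists_gridOrbit hr0 hr1 hρ x with hinf | ⟨k, t, h, rfl⟩
  · have horb : ∀ n : ℕ, GridOrbit r ρ (fun _ => n) (fun _ => 1) := fun n =>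
      ⟨fun _ => ⟨zero_le_one, le_rfl⟩, fun _ => .inr <| .inr <| .inr <| .inr ⟨rfl, rfl⟩⟩
    have hlim : Tendsto (fun n => (horb n).toPlus) atTop (𝓝 x) := by
      rw [tendsto_subtype_rng, tendsto_pi_nhds]
      intro i
      rw [hinf i]
      exact tendsto_gridPoint_infty
    obtain ⟨n, hn⟩ := (hlim.eventually (hU.mem_nhds hx)).exists
    exact ⟨_, _, horb n, hn, fun _ => one_pos⟩
  · by_cases h0 : t 0 = 0
    · have ht0 : ∀ i, t i = 0 := fun i => (h.eq_zero_iff hr0 hρ i).1 h0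
      have horb : ∀ n : ℕ, GridOrbit r ρ k (fun _ => 1 / ((n : ℝ) + 1)) := fun n =>
        ⟨fun _ => ⟨by positivity, by
            rw [div_le_one (by positivity)]; linarith [(n.cast_nonneg : (0 : ℝ) ≤ n)]⟩,
          fun i => by simpa only [ht0] using GridStep.const (by simpa only [ht0] using h.2 i) _⟩
      have hlim : Tendsto (fun n => (horb n).toPlus) atTop (𝓝 h.toPlus) := by
        rw [tendsto_subtype_rng, tendsto_pi_nhds]
        intro i
        have := ((continuous_gridPoint (k i)).tendsto 0).comp
          tendsto_one_div_add_atTop_nhds_zero_nat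
        simpa only [GridOrbit.toPlus, ht0] using! this
      obtain ⟨n, hn⟩ := (hlim.eventually (hU.mem_nhds hx)).exists
      exact ⟨_, _, horb n, hn, fun _ => by positivity⟩
    · exact ⟨k, t, h, hx, fun i =>
        lt_of_le_of_ne (h.1 i).1 fun hi => h0 ((h.eq_zero_iff hr0 hρ i).2 hi.symm)⟩

/-- Shrinking an orbit slightly towards the even integers does not leave an open set. -/
theorem GridOrbit.exists_forall_mul_left_mem {k : ℕ → ℕ} {t : ℕ → ℝ} (h : GridOrbit r ρ k t)
    {V : Set (MahavierPlus (Hrel r ρ))} (hV : IsOpen V) (hh : h.toPlus ∈ V) :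
    ∃ c₀ ∈ Ioo (0 : ℝ) 1, ∀ c (hc : c ∈ Icc (0 : ℝ) 1), c₀ < c → (h.mul_left hc).toPlus ∈ V := by
  let φ : Icc (0 : ℝ) 1 → MahavierPlus (Hrel r ρ) := fun c => (h.mul_left c.2).toPlus
  have hφ : Continuous φ := Continuous.subtype_mk (continuous_pi fun i =>
    (continuous_gridPoint (k i)).comp (continuous_subtype_val.mul continuous_const)) _
  have hφ1 : φ 1 ∈ V := by
    convert hh using 1
    exact Subtype.ext (funext fun i => by simp [φ, GridOrbit.toPlus])
  obtain ⟨ε, hε, hball⟩ := Metric.isOpen_iff.1 (hV.preimage hφ) 1 hφ1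
  refine ⟨max (1 / 2) (1 - ε), ⟨by positivity, max_lt (by norm_num) (by linarith)⟩,
    fun c hc hlt => ?_⟩
  refine hball (a := ⟨c, hc⟩) ?_
  rw [Metric.mem_ball, Subtype.dist_eq, Real.dist_eq, abs_lt]
  have := (le_max_right _ _).trans_lt hlt
  simp only [Icc.coe_one]
  constructor <;> linarith [hc.2]

theorem leads_gridPoint_zero {t : ℝ} (ht : t ∈ Icc (0 : ℝ) 1) (k : ℕ) :
    Leads (Hrel r ρ) k (gridPoint k t) (gridPoint 0 t) := by
  induction k with
  | zero => exact Leads.refl _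
  | succ k ih =>
    rw [add_comm]
    refine Leads.trans (Leads.single (GridStep.mem_Hrel ?_ ht ht)) ih
    exact .inr <| .inr <| .inr <| .inl ⟨by omega, rfl⟩

theorem leads_zero_gridPoint {t : ℝ} (ht : t ∈ Icc (0 : ℝ) 1) (k : ℕ) :
    Leads (Hrel r ρ) k (gridPoint 0 t) (gridPoint k t) := by
  induction k with
  | zero => exact Leads.refl _
  | succ k ih =>
    exact ih.trans (Leads.single (GridStep.mem_Hrel (.inr <| .inr <| .inl ⟨rfl, rfl⟩) ht ht))

theorem leads_pow_mul (hr0 : 0 < r) (hr1 : r < 1) {t : ℝ} (ht : t ∈ Icc (0 : ℝ) 1) (a : ℕ) :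
    Leads (Hrel r ρ) a (gridPoint 0 t) (gridPoint 0 (r ^ a * t)) := by
  have hmem : ∀ a : ℕ, r ^ a * t ∈ Icc (0 : ℝ) 1 := fun a =>
    ⟨mul_nonneg (by positivity) ht.1, mul_le_one₀ (pow_le_one₀ hr0.le hr1.le) ht.1 ht.2⟩
  induction a with
  | zero => simpa using Leads.refl _
  | succ a ih =>
    exact ih.trans (Leads.single
      (GridStep.mem_Hrel (.inl ⟨rfl, rfl, by ring⟩) (hmem a) (hmem (a + 1))))

theorem leads_expand_pow_mul (hρ : 1 < ρ) {t : ℝ} (ht : 0 ≤ t) (b : ℕ) (hb : ρ ^ b * t ≤ 1) :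
    Leads (Hrel r ρ) b (gridPoint 0 t) (gridPoint 0 (ρ ^ b * t)) := by
  have hρ0 : 0 < ρ := by linarith
  induction b with
  | zero => simpa using Leads.refl _
  | succ b ih =>
    have hle : ρ ^ b * t ≤ 1 := by
      refine le_trans ?_ hb
      exact mul_le_mul_of_nonneg_right (pow_le_pow_right₀ hρ.le b.le_succ) ht
    exact (ih hle).trans (Leads.single (GridStep.mem_Hrel
      (.inr <| .inl ⟨rfl, rfl, by ring⟩) ⟨by positivity, hle⟩ ⟨by positivity, hb⟩))

theorem topologicallyMixing_shiftPlus_Hrel (hNC : NeverConnect r ρ) :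
    TopologicallyMixing (shiftPlus (Hrel r ρ)) := by
  obtain ⟨hr0, hr1, hρ, -⟩ := id hNC
  have hρ0 : 0 < ρ := by linarith
  intro U V hU hV hUne hVne
  obtain ⟨k, t, hu, huU, htpos⟩ := exists_pos_gridOrbit_mem hr0 hr1 hρ hU hUne
  obtain ⟨l, s, hv, hvV, hspos⟩ := exists_pos_gridOrbit_mem hr0 hr1 hρ hV hVne
  obtain ⟨m, hm⟩ := exists_forall_agree_mem hU huU
  obtain ⟨c₀, hc₀, hcV⟩ := hv.exists_forall_mul_left_mem hV hvV
  have htm := htpos m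
  have hs0 := hspos 0
  obtain ⟨a, b, hab⟩ := hNC.exists_pow_mul_pow_mem_Ioo (α := c₀ * s 0 / t m) (β := s 0 / t m)
    (div_pos (mul_pos hc₀.1 hs0) htm)
    (div_lt_div_of_pos_right (by nlinarith [hc₀.2]) htm)
  rw [mem_Ioo, div_lt_iff₀ htm, lt_div_iff₀ htm] at hab
  set q := ρ ^ b * r ^ a * t m with hq
  have hq0 : 0 < q := by positivity
  have hqI : q ∈ Icc (0 : ℝ) 1 := ⟨hq0.le, hab.2.le.trans (hv.1 0).2⟩
  have hc : q / s 0 ∈ Icc (0 : ℝ) 1 := ⟨by positivity, (div_le_one hs0).2 hab.2.le⟩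
  have hwV := hcV _ hc ((lt_div_iff₀ hs0).2 hab.1)
  refine ⟨m + (k m + a + b + l 0), fun n hn => ?_⟩
  obtain ⟨j, rfl⟩ := Nat.exists_eq_add_of_le hn
  have hρr : ρ ^ b * (r ^ a * t m) = q := by rw [hq]; ring
  have h₁ : Leads (Hrel r ρ) _ _ _ := leads_gridPoint_zero (hu.1 m) (k m)
  have h₂ : Leads (Hrel r ρ) _ _ _ := leads_pow_mul hr0 hr1 (hu.1 m) a
  have h₃ : Leads (Hrel r ρ) b _ _ :=
    leads_expand_pow_mul hρ (t := r ^ a * t m) (by positivity) b (by rw [hρr]; exact hqI.2)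
  rw [hρr] at h₃
  have h₄ : Leads (Hrel r ρ) _ _ _ := leads_zero_gridPoint hqI (l 0)
  have h₅ : Leads (Hrel r ρ) j (gridPoint (l 0) q) (gridPoint (l 0) q) :=
    Leads.stay (GridStep.mem_Hrel (.inr <| .inr <| .inr <| .inr ⟨rfl, rfl⟩) hqI hqI) j
  obtain ⟨y, hy, hy0, hyw⟩ := ((((h₁.trans h₂).trans h₃).trans h₄).trans h₅)
    (hv.mul_left hc).toPlus.1 (hv.mul_left hc).toPlus.2
    (by simp [GridOrbit.toPlus, div_mul_cancel₀ _ hs0.ne'])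
  obtain ⟨z, hz, hzu, hzy⟩ := exists_mahavierPlus_append hu.toPlus.2 hy m hy0
  refine ⟨_, ⟨⟨z, hz⟩, hm _ hzu, rfl⟩, ?_⟩
  convert hwV using 1
  refine Subtype.ext (funext fun i => ?_)
  rw [iterate_shiftPlus_apply, ← hyw, ← hzy]
  exact congrArg z (by ring)

theorem relOne_shiftPlus {x y : MahavierPlus (Hrel r ρ)} (h : relOne r ρ x y) :
    relOne r ρ (shiftPlus (Hrel r ρ) x) (shiftPlus (Hrel r ρ) y) := by
  rcases h with rfl | h
  · exact .inl rfl
  · exact .inr fun i => h (i + 1)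

theorem not_isEvenPt_gridPoint_one (k : ℕ) : ¬ IsEvenPt (gridPoint k 1) := by
  rintro ⟨m, hm, h⟩
  obtain ⟨y, hy, hyk⟩ := exists_coe_eq_gridPoint k (t := 1) ⟨zero_le_one, le_rfl⟩
  rw [hyk, OnePoint.coe_eq_coe] at h
  rw [h] at hy
  have := eq_of_two_mul_add_eq (k := k) (l := m) (t := 1) (s := 0) (by simp) (by simp)
    (by simpa using hy)
  exact zero_ne_one this.2

/-- Orbits that leave the even integers are alone in their class. -/
theorem eq_of_quot_mk_eq {x y : MahavierPlus (Hrel r ρ)} (hx : ∃ i, ¬ IsEvenPt (x.1 i))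
    (h : Quot.mk (relOne r ρ) x = Quot.mk (relOne r ρ) y) : x = y := by
  obtain ⟨i, hi⟩ := hx
  have hcompat : ∀ a b, relOne r ρ a b → (x = a) = (x = b) := by
    rintro a b (rfl | hab)
    · rfl
    · refine propext ⟨?_, ?_⟩
      · rintro rfl
        exact (hi (hab i).1).elim
      · rintro rfl
        exact (hi (hab i).2).elim
  exact (congrArg (Quot.lift (fun a => x = a) hcompat) h).mp rfl

end Grid

/-- For `(r,ρ) ∈ 𝒩𝒞`, the shift `σ_H⁺` induces a well-defined continuous map `(σ_H⁺)⋆` on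
`𝕏_H⁺/~₁` with `[x] ↦ [σ_H⁺ x]`; it is not a homeomorphism (non-invertible), and
`(𝕏_H⁺/~₁, (σ_H⁺)⋆)` is topologically mixing. -/
theorem statement15 (r ρ : ℝ) (hNC : NeverConnect r ρ) :
    ∃ g : Quot (relOne r ρ) → Quot (relOne r ρ),
      (∀ x : ↥(MahavierPlus (Hrel r ρ)),
        g (Quot.mk _ x) = Quot.mk _ (shiftPlus (Hrel r ρ) x)) ∧
      Continuous g ∧ ¬ IsHomeomorph g ∧ TopologicallyMixing g := by
  refine ⟨Quot.map (shiftPlus (Hrel r ρ)) fun _ _ => relOne_shiftPlus, fun _ => rfl, ?_, ?_, ?_⟩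
  · exact continuous_quot_lift _ (continuous_quot_mk.comp continuous_shiftPlus)
  · intro hhom
    have hone : (1 : ℝ) ∈ Set.Icc (0 : ℝ) 1 := ⟨zero_le_one, le_rfl⟩
    have ha : GridOrbit r ρ (fun _ => 0) (fun _ => 1) :=
      ⟨fun _ => hone, fun _ => .inr <| .inr <| .inr <| .inr ⟨rfl, rfl⟩⟩
    have hb : GridOrbit r ρ (fun i => if i = 0 then 1 else 0) (fun _ => 1) := by
      refine ⟨fun _ => hone, fun i => ?_⟩
      rcases i with _ | i
      · exact .inr <| .inr <| .inr <| .inl ⟨rfl, rfl⟩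
      · exact .inr <| .inr <| .inr <| .inr ⟨rfl, rfl⟩
    have hmk : Quot.mk (relOne r ρ) ha.toPlus = Quot.mk (relOne r ρ) hb.toPlus :=
      hhom.injective (congrArg (Quot.mk (relOne r ρ)) (Subtype.ext rfl))
    have hab := eq_of_quot_mk_eq ⟨0, not_isEvenPt_gridPoint_one 0⟩ hmk
    have h0 : gridPoint 0 1 = gridPoint 1 1 := congrFun (congrArg Subtype.val hab) 0
    obtain ⟨y, hy, hyk⟩ := exists_coe_eq_gridPoint 0 hone
    obtain ⟨z, hz, hzk⟩ := exists_coe_eq_gridPoint 1 hone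
    rw [hyk, hzk, OnePoint.coe_eq_coe] at h0
    rw [h0, hz] at hy
    norm_num at hy
  · exact (topologicallyMixing_shiftPlus_Hrel hNC).of_semiconj continuous_quot_mk
      Quot.mk_surjective fun _ => rfl
end
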